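/- arXiv:2603.21021 — 4 statements merged into one kernel-verified Lean document; each statement's English description precedes it below -/
import Mathlib

section
/- Let m and n be positive integers with m odd, let A and B be m×n matrices and X an n×n matrix over a commutative ring, and set Y = A·X·Bᵗ − B·Xᵗ·Aᵗ. Then Σ_{i=1}^m (−1)^{i−1} (Σ_{j=1}^n A_{i,j}) · Pf(Y(i)) = (−1)^{binom((m−1)/2, 2)} · g_{A,B}(X), where Y(i) arises from Y by deleting the i-th row and column. -/
open Matrix

/-- The Pfaffian of a `2k × 2k` matrix, defined as the sum over perfect matchings
of `{1, …, 2k}` (encoded by the permutation listing the matched pairs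
`(σ(1),σ(2)), (σ(3),σ(4)), …` in normal form, whose sign equals
`(−1)^{cr(μ)}` for the matching `μ`) of the sign of the matching times the
product of the corresponding matrix entries. -/
def pfaffian {R : Type*} [CommRing R] {k : ℕ} (Y : Matrix (Fin (2*k)) (Fin (2*k)) R) : R :=
  ∑ σ ∈ Finset.univ.filter (fun σ : Equiv.Perm (Fin (2*k)) =>
      (∀ i : Fin k,
        σ ⟨2*(i:ℕ), by have := i.isLt; omega⟩ < σ ⟨2*(i:ℕ)+1, by have := i.isLt; omega⟩) ∧
      (∀ i j : Fin k, i < j →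
        σ ⟨2*(i:ℕ), by have := i.isLt; omega⟩ < σ ⟨2*(j:ℕ), by have := j.isLt; omega⟩)),
    ((Equiv.Perm.sign σ : ℤ) : R) *
      ∏ i : Fin k, Y (σ ⟨2*(i:ℕ), by have := i.isLt; omega⟩) (σ ⟨2*(i:ℕ)+1, by have := i.isLt; omega⟩)

/-- Strictly increasing functions `Fin k → Fin n`; these encode the `k`-element
subsets of `{1,…,n}` listed in increasing order. -/
def incrFuns (k n : ℕ) : Finset (Fin k → Fin n) :=
  Finset.univ.filter fun f => ∀ a b : Fin k, a < b → f a < f b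

/-- For odd `m = 2k+1`: the `m × m` matrix `(Aᴵ Bᴶ)` obtained by concatenating the
`k+1` columns of `A` indexed by `fI` with the `k` columns of `B` indexed by `fJ`. -/
def concatCBodd {R : Type*} [CommRing R] {k n : ℕ} (A B : Matrix (Fin (2*k+1)) (Fin n) R)
    (fI : Fin (k+1) → Fin n) (fJ : Fin k → Fin n) :
    Matrix (Fin (2*k+1)) (Fin (2*k+1)) R :=
  Matrix.of fun i j =>
    if h : (j:ℕ) < k+1 then A i (fI ⟨j, h⟩)
    else B i (fJ ⟨(j:ℕ) - (k+1), by have := j.isLt; omega⟩)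

/-- The `(k+1) × (k+1)` matrix `(𝟏 X_{I,J})` obtained by prepending an all-ones column
to the submatrix of `X` with rows indexed by `fI` and columns indexed by `fJ`. -/
def oneCol {R : Type*} [CommRing R] {k n : ℕ} (X : Matrix (Fin n) (Fin n) R)
    (fI : Fin (k+1) → Fin n) (fJ : Fin k → Fin n) :
    Matrix (Fin (k+1)) (Fin (k+1)) R :=
  Matrix.of fun i j =>
    if h : (j:ℕ) = 0 then 1 else X (fI i) (fJ ⟨(j:ℕ) - 1, by have := j.isLt; omega⟩)

/-- `g_{A,B}(X) = Σ_{I,J⊆[n], |I|=(m+1)/2, |J|=(m-1)/2} det(𝟏 X_{I,J}) · det(Aᴵ Bᴶ)`. -/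
def gAB {R : Type*} [CommRing R] {k n : ℕ} (A B : Matrix (Fin (2*k+1)) (Fin n) R)
    (X : Matrix (Fin n) (Fin n) R) : R :=
  ∑ fI ∈ incrFuns (k+1) n, ∑ fJ ∈ incrFuns k n,
    (oneCol X fI fJ).det * (concatCBodd A B fI fJ).det

/-- pairs -/
def prEq (k : ℕ) : Fin k × Fin 2 ≃ Fin (2*k) := finProdFinEquiv.trans (finCongr (Nat.mul_comm k 2))

theorem prEq_val (k : ℕ) (i : Fin k) (b : Fin 2) : (prEq k (i, b) : ℕ) = 2 * i + b := by
  simp [prEq]; omega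

theorem prEq_zero (k : ℕ) (i : Fin k) (h : 2 * (i:ℕ) < 2 * k) : (⟨2 * (i:ℕ), h⟩ : Fin (2*k)) = prEq k (i, 0) := by
  ext; simp [prEq_val]

theorem prEq_one (k : ℕ) (i : Fin k) (h : 2 * (i:ℕ) + 1 < 2 * k) : (⟨2 * (i:ℕ) + 1, h⟩ : Fin (2*k)) = prEq k (i, 1) := by
  ext; simp [prEq_val]

/-- normal form -/
def IsNrm {k : ℕ} (σ : Equiv.Perm (Fin (2*k))) : Prop :=
  (∀ i : Fin k, σ (prEq k (i, 0)) < σ (prEq k (i, 1))) ∧ StrictMono (fun i : Fin k => σ (prEq k (i, 0)))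

noncomputable instance {k : ℕ} : DecidablePred (IsNrm (k := k)) := fun _ => Classical.propDecidable _

/-- wreath element on pairs -/
def wr0 {k : ℕ} (π : Equiv.Perm (Fin k)) (ε : Fin k → Equiv.Perm (Fin 2)) : Equiv.Perm (Fin k × Fin 2) :=
  (Equiv.prodCongrRight ε).trans (Equiv.prodCongrLeft fun _ => π)

/-- wreath element -/
def wr {k : ℕ} (π : Equiv.Perm (Fin k)) (ε : Fin k → Equiv.Perm (Fin 2)) : Equiv.Perm (Fin (2*k)) :=
  (prEq k).permCongr (wr0 π ε)

theorem wr_apply {k : ℕ} (π : Equiv.Perm (Fin k)) (ε : Fin k → Equiv.Perm (Fin 2)) (i : Fin k) (b : Fin 2) :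
    wr π ε (prEq k (i, b)) = prEq k (π i, ε i b) := by
  simp [wr, wr0, Equiv.permCongr_apply]

theorem sign_wr {k : ℕ} (π : Equiv.Perm (Fin k)) (ε : Fin k → Equiv.Perm (Fin 2)) :
    Equiv.Perm.sign (wr π ε) = ∏ i, Equiv.Perm.sign (ε i) := by
  rw [wr, Equiv.Perm.sign_permCongr, wr0, Equiv.Perm.sign_trans, Equiv.Perm.sign_prodCongrRight,
    Equiv.Perm.sign_prodCongrLeft]
  simp

theorem perm2_cases (s : Equiv.Perm (Fin 2)) : (s 0 = 0 ∧ s 1 = 1) ∨ (s 0 = 1 ∧ s 1 = 0) := by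
  revert s; decide

theorem perm2_ext (s t : Equiv.Perm (Fin 2)) (h : s 0 = t 0) : s = t := by
  revert s t; decide

theorem perm_pair_ext {k : ℕ} (σ τ : Equiv.Perm (Fin (2*k))) (h : ∀ i b, σ (prEq k (i, b)) = τ (prEq k (i, b))) :
    σ = τ := by
  ext x
  obtain ⟨⟨i, b⟩, rfl⟩ := (prEq k).surjective x
  rw [h]

theorem wr_inj {k : ℕ} (τ τ' : Equiv.Perm (Fin (2*k))) (hτ : IsNrm τ) (hτ' : IsNrm τ')
    (π π' : Equiv.Perm (Fin k)) (ε ε' : Fin k → Equiv.Perm (Fin 2))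
    (h : τ * wr π ε = τ' * wr π' ε') : τ = τ' ∧ π = π' ∧ ε = ε' := by
  have h1 : ∀ i b, τ (prEq k (π i, ε i b)) = τ' (prEq k (π' i, ε' i b)) := by
    intro i b
    have := congrArg (fun s => s (prEq k (i, b))) h
    simpa [wr_apply] using this
  have h2 : ε = ε' := by
    funext i
    have a0 := h1 i 0
    have a1 := h1 i 1
    have n1 := hτ.1 (π i)
    have n2 := hτ'.1 (π' i)
    apply perm2_ext
    rcases perm2_cases (ε i) with ⟨e0, e1⟩ | ⟨e0, e1⟩ <;>
    rcases perm2_cases (ε' i) with ⟨f0, f1⟩ | ⟨f0, f1⟩ <;>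
    rw [e0, f0] at a0 ⊢ <;> rw [e1, f1] at a1 <;> exfalso <;> rw [a0, a1] at n1 <;> exact absurd n1 (not_lt_of_gt n2)
  subst h2
  have h3 : ∀ i b, τ (prEq k (π i, b)) = τ' (prEq k (π' i, b)) := by
    intro i b
    simpa using h1 i ((ε i).symm b)
  have h4 : (fun i : Fin k => τ (prEq k (i, 0))) = (fun i : Fin k => τ' (prEq k (i, 0))) := by
    apply (StrictMono.range_inj hτ.2 hτ'.2).1
    ext x
    constructor
    · rintro ⟨i, rfl⟩
      exact ⟨π' (π.symm i), by simpa using (h3 (π.symm i) 0).symm⟩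
    · rintro ⟨i, rfl⟩
      exact ⟨π (π'.symm i), by simpa using (h3 (π'.symm i) 0)⟩
  have h5 : π = π' := by
    ext1 i
    have := h3 i 0
    rw [← congrFun h4 (π' i)] at this
    simpa using this
  subst h5
  refine ⟨?_, rfl, rfl⟩
  apply perm_pair_ext
  intro i b
  simpa using h3 (π.symm i) b

theorem wr_surj {k : ℕ} (σ : Equiv.Perm (Fin (2*k))) :
    ∃ τ π ε, IsNrm τ ∧ τ * wr (k := k) π ε = σ := by
  classical
  let ε : Fin k → Equiv.Perm (Fin 2) := fun i =>
    if σ (prEq k (i, 0)) < σ (prEq k (i, 1)) then 1 else Equiv.swap 0 1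
  let m : Fin k → Fin (2*k) := fun i => σ (prEq k (i, (ε i).symm 0))
  let ρ := Tuple.sort m
  have hm : Function.Injective m := by
    intro i j hij
    have := (prEq k).injective (σ.injective hij)
    exact (Prod.ext_iff.1 this).1
  have hmono : Monotone (m ∘ ρ) := Tuple.monotone_sort m
  refine ⟨σ * (wr ρ⁻¹ ε)⁻¹, ρ⁻¹, ε, ?_, by simp⟩
  have key : ∀ j b, (σ * (wr ρ⁻¹ ε)⁻¹) (prEq k (j, b)) = σ (prEq k (ρ j, (ε (ρ j)).symm b)) := by
    intro j b
    rw [Equiv.Perm.mul_apply]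
    congr 1
    rw [Equiv.Perm.inv_eq_iff_eq, wr_apply]
    simp
  constructor
  · intro i
    rw [key, key]
    generalize ρ i = j
    by_cases hj : σ (prEq k (j, 0)) < σ (prEq k (j, 1))
    · simp only [ε, hj, if_true]
      exact hj
    · have hne : σ (prEq k (j, 0)) ≠ σ (prEq k (j, 1)) := by simp
      simp [ε, hj]
      exact lt_of_le_of_ne (not_lt.1 hj) hne.symm
  · have : StrictMono (m ∘ ρ) := hmono.strictMono_of_injective (hm.comp ρ.injective)
    convert this using 1
    funext i
    rw [key]; rfl

theorem pf_fact {R : Type*} [CommRing R] (k : ℕ) (Z : Matrix (Fin (2*k)) (Fin (2*k)) R) :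
    (k.factorial : R) * pfaffian (Z - Zᵀ) =
      ∑ σ : Equiv.Perm (Fin (2*k)), ((Equiv.Perm.sign σ : ℤ) : R) *
        ∏ i : Fin k, Z (σ (prEq k (i, 0))) (σ (prEq k (i, 1))) := by
  classical
  have hpf : pfaffian (Z - Zᵀ) = ∑ τ ∈ Finset.univ.filter (fun σ : Equiv.Perm (Fin (2*k)) => IsNrm σ),
      ((Equiv.Perm.sign τ : ℤ) : R) * ∏ i : Fin k, (Z - Zᵀ) (τ (prEq k (i, 0))) (τ (prEq k (i, 1))) := by
    unfold pfaffian
    simp only [prEq_zero, prEq_one]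
    congr 1
    ext x
    simp only [Finset.mem_filter, Finset.mem_univ, true_and]
    exact ⟨fun h => ⟨h.1, fun i j hij => h.2 i j hij⟩, fun h => ⟨h.1, fun i j hij => h.2 hij⟩⟩
  have hterm : ∀ (τ : Equiv.Perm (Fin (2*k))) (π : Equiv.Perm (Fin k)),
      ((Equiv.Perm.sign τ : ℤ) : R) * ∏ i : Fin k, (Z - Zᵀ) (τ (prEq k (i, 0))) (τ (prEq k (i, 1))) =
      ∑ ε : Fin k → Equiv.Perm (Fin 2), ((Equiv.Perm.sign (τ * wr π ε) : ℤ) : R) *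
        ∏ i : Fin k, Z ((τ * wr π ε) (prEq k (i, 0))) ((τ * wr π ε) (prEq k (i, 1))) := by
    intro τ π
    rw [← Equiv.prod_comp π]
    have : ∀ i, (Z - Zᵀ) (τ (prEq k (π i, 0))) (τ (prEq k (π i, 1))) =
        ∑ s : Equiv.Perm (Fin 2), ((Equiv.Perm.sign s : ℤ) : R) *
          Z (τ (prEq k (π i, s 0))) (τ (prEq k (π i, s 1))) := by
      intro i
      have hu : (Finset.univ : Finset (Equiv.Perm (Fin 2))) = {1, Equiv.swap 0 1} := by decide
      rw [hu, Finset.sum_pair (by decide)]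
      simp [sub_eq_add_neg]
    simp_rw [this]
    rw [Finset.prod_univ_sum, Fintype.piFinset_univ, Finset.mul_sum]
    apply Finset.sum_congr rfl
    intro ε _
    rw [Finset.prod_mul_distrib, ← mul_assoc]
    simp only [Equiv.Perm.mul_apply, wr_apply, Equiv.Perm.sign_mul, sign_wr]
    push_cast
    rfl
  have hcard : (k.factorial : R) * pfaffian (Z - Zᵀ) = ∑ _π : Equiv.Perm (Fin k), pfaffian (Z - Zᵀ) := by
    simp [Fintype.card_perm]
  rw [hcard, hpf]
  have h2 : ∀ π : Equiv.Perm (Fin k), ∑ τ ∈ Finset.univ.filter (fun σ : Equiv.Perm (Fin (2*k)) => IsNrm σ),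
      ((Equiv.Perm.sign τ : ℤ) : R) * ∏ i : Fin k, (Z - Zᵀ) (τ (prEq k (i, 0))) (τ (prEq k (i, 1))) =
      ∑ τ ∈ Finset.univ.filter (fun σ : Equiv.Perm (Fin (2*k)) => IsNrm σ),
      ∑ ε : Fin k → Equiv.Perm (Fin 2), ((Equiv.Perm.sign (τ * wr π ε) : ℤ) : R) *
        ∏ i : Fin k, Z ((τ * wr π ε) (prEq k (i, 0))) ((τ * wr π ε) (prEq k (i, 1))) :=
    fun π => Finset.sum_congr rfl fun τ _ => hterm τ π
  rw [Finset.sum_congr rfl (fun π _ => h2 π)]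
  simp_rw [← Finset.sum_product']
  refine Finset.sum_bij (fun x _ => x.2.1 * wr x.1 x.2.2) (by simp) ?_ ?_ (by simp)
  · rintro ⟨π, τ, ε⟩ h ⟨π', τ', ε'⟩ h' e
    simp at h h' e
    obtain ⟨rfl, rfl, rfl⟩ := wr_inj τ τ' h h' π π' ε ε' e
    rfl
  · intro σ _
    obtain ⟨τ, π, ε, h, e⟩ := wr_surj σ
    exact ⟨⟨π, τ, ε⟩, by simpa using h, e⟩
/-- concatenation of index sets -/
def cs (k : ℕ) : Fin (k+1) ⊕ Fin k ≃ Fin (2*k+1) := finSumFinEquiv.trans (finCongr (by omega))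

theorem cs_inl (k : ℕ) (a : Fin (k+1)) : (cs k (Sum.inl a) : ℕ) = a := by simp [cs]
theorem cs_inr (k : ℕ) (a : Fin k) : (cs k (Sum.inr a) : ℕ) = k + 1 + a := by simp [cs]

theorem concat_inl {R : Type*} [CommRing R] {k n : ℕ} (A B : Matrix (Fin (2*k+1)) (Fin n) R)
    (F : Fin (k+1) → Fin n) (g : Fin k → Fin n) (i) (a) :
    concatCBodd A B F g i (cs k (Sum.inl a)) = A i (F a) := by
  simp [concatCBodd, cs_inl]
  intro h; omega

theorem concat_inr {R : Type*} [CommRing R] {k n : ℕ} (A B : Matrix (Fin (2*k+1)) (Fin n) R)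
    (F : Fin (k+1) → Fin n) (g : Fin k → Fin n) (i) (a) :
    concatCBodd A B F g i (cs k (Sum.inr a)) = B i (g a) := by
  simp [concatCBodd, cs_inr]
  intro h; omega

/-- interleaving as function on naturals -/
def ieN (k x : ℕ) : ℕ := if x % 2 = 1 then (x+1)/2 else if x = 0 then 0 else k + x/2

theorem ieN_lt (k x : ℕ) (h : x < 2*k+1) : ieN k x < 2*k+1 := by
  unfold ieN; split_ifs <;> omega

theorem ieN_inj (k x y : ℕ) (h : x < 2*k+1) (h' : y < 2*k+1) (e : ieN k x = ieN k y) : x = y := by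
  unfold ieN at e; split_ifs at e <;> omega

/-- interleaving -/
noncomputable def ie (k : ℕ) : Equiv.Perm (Fin (2*k+1)) :=
  Equiv.ofBijective (fun x => ⟨ieN k x, ieN_lt k x x.2⟩)
    (Finite.injective_iff_bijective.1 fun x y h => Fin.ext (ieN_inj k x y x.2 y.2 (by simpa using h)))

theorem ie_val (k : ℕ) (x) : (ie k x : ℕ) = ieN k x := rfl

theorem ie_zero (k : ℕ) : ie k 0 = cs k (Sum.inl 0) := by
  ext; simp [ie_val, cs_inl, ieN]

theorem ie_A (k : ℕ) (j : Fin k) : ie k (Fin.succ (prEq k (j, 0))) = cs k (Sum.inl j.succ) := by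
  ext; simp [ie_val, cs_inl, ieN, prEq_val]; omega

theorem ie_B (k : ℕ) (j : Fin k) : ie k (Fin.succ (prEq k (j, 1))) = cs k (Sum.inr j) := by
  ext; simp [ie_val, cs_inr, ieN, prEq_val]; split_ifs <;> omega

theorem prod_t (j : ℕ) : ∏ p ∈ Finset.range (2*j+1), (if p % 2 = 0 ∧ 0 < p then (-1 : ℤˣ) else 1) = (-1)^j := by
  induction j with
  | zero => simp
  | succ j ih =>
    rw [show 2 * (j+1) + 1 = (2*j+1)+1+1 by ring, Finset.prod_range_succ, Finset.prod_range_succ, ih,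
      if_neg (by omega), if_pos (by omega), pow_succ, mul_one]

theorem prod_u (k : ℕ) : ∏ q ∈ Finset.range (2*k+1), (if q % 2 = 1 then (-1 : ℤˣ)^(q/2) else 1) = (-1)^(k.choose 2) := by
  induction k with
  | zero => simp
  | succ j ih =>
    rw [show 2 * (j+1) + 1 = (2*j+1)+1+1 by ring, Finset.prod_range_succ, Finset.prod_range_succ, ih,
      if_pos (by omega), if_neg (by omega), mul_one, Nat.choose_succ_succ' j 1, Nat.choose_one_right,
      show (2*j+1)/2 = j by omega, pow_add, mul_comm]

theorem sign_ie (k : ℕ) : Equiv.Perm.sign (ie k) = (-1)^(k.choose 2) := by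
  rw [Equiv.Perm.sign_eq_prod_prod_Iio, ← prod_u, ← Fin.prod_univ_eq_prod_range (fun q => if q % 2 = 1 then (-1 : ℤˣ)^(q/2) else 1)]
  apply Finset.prod_congr rfl
  intro q _
  have h1 : ∏ i ∈ Finset.Iio q, (if ie k i < ie k q then (1 : ℤˣ) else -1) =
      ∏ i ∈ Finset.Iio q, (fun p : ℕ => if p % 2 = 0 ∧ 0 < p ∧ (q:ℕ) % 2 = 1 then (-1 : ℤˣ) else 1) (Fin.valEmbedding i) := by
    apply Finset.prod_congr rfl
    intro p hp
    have hp' : (p:ℕ) < q := by simpa using hp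
    have := q.2
    simp only [Fin.lt_def, ie_val, ieN, Fin.valEmbedding_apply]
    split_ifs <;> first | rfl | omega
  rw [h1, ← Finset.prod_map (Finset.Iio q) Fin.valEmbedding (fun p : ℕ => if p % 2 = 0 ∧ 0 < p ∧ (q:ℕ) % 2 = 1 then (-1 : ℤˣ) else 1), Fin.map_valEmbedding_Iio, Nat.Iio_eq_range]
  split_ifs with hq
  · obtain ⟨j, hj⟩ : ∃ j, (q:ℕ) = 2*j+1 := ⟨q/2, by omega⟩
    simp only [hq, and_true]
    rw [hj, prod_t, show (2*j+1)/2 = j by omega]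
  · simp [hq]

theorem laplace_step {R : Type*} [CommRing R] {k n : ℕ} (A B : Matrix (Fin (2*k+1)) (Fin n) R)
    (c : Fin n) (f g : Fin k → Fin n) :
    ∑ i : Fin (2*k+1), (-1 : R)^(i:ℕ) * A i c *
      ∑ σ : Equiv.Perm (Fin (2*k)), ((Equiv.Perm.sign σ : ℤ) : R) *
        ∏ j : Fin k, (A (i.succAbove (σ (prEq k (j, 0)))) (f j) * B (i.succAbove (σ (prEq k (j, 1)))) (g j))
    = (-1 : R)^(k.choose 2) * (concatCBodd A B (Fin.cons c f : Fin (k+1) → Fin n) g).det := by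
  have h := Matrix.det_permute' (ie k) (concatCBodd A B (Fin.cons c f : Fin (k+1) → Fin n) g)
  rw [sign_ie] at h
  push_cast at h
  rw [← h, Matrix.det_succ_column_zero]
  apply Finset.sum_congr rfl
  intro i _
  congr 1
  · rw [Matrix.det_apply']
    apply Finset.sum_congr rfl
    intro σ _
    congr 1
    rw [← Equiv.prod_comp (prEq k), Fintype.prod_prod_type]
    apply Finset.prod_congr rfl
    intro j _
    simp [Fin.prod_univ_two, ie_A, ie_B, concat_inl, concat_inr]

theorem expand_step {R : Type*} [CommRing R] {k n : ℕ} (A B : Matrix (Fin (2*k+1)) (Fin n) R)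
    (X : Matrix (Fin n) (Fin n) R) :
    (k.factorial : R) * (∑ i : Fin (2*k+1),
        (-1 : R)^(i:ℕ) * (∑ j : Fin n, A i j) *
          pfaffian ((A * X * Bᵀ - B * Xᵀ * Aᵀ).submatrix i.succAbove i.succAbove)) =
    (-1 : R)^(k.choose 2) * ∑ F : Fin (k+1) → Fin n, ∑ g : Fin k → Fin n,
      (∏ j : Fin k, X (F j.succ) (g j)) * (concatCBodd A B F g).det := by
  have hZ : ∀ i : Fin (2*k+1), (k.factorial : R) *
      pfaffian ((A * X * Bᵀ - B * Xᵀ * Aᵀ).submatrix i.succAbove i.succAbove) =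
      ∑ f : Fin k → Fin n, ∑ g : Fin k → Fin n, (∏ j, X (f j) (g j)) *
      ∑ σ : Equiv.Perm (Fin (2*k)), ((Equiv.Perm.sign σ : ℤ) : R) *
        ∏ j : Fin k, (A (i.succAbove (σ (prEq k (j, 0)))) (f j) * B (i.succAbove (σ (prEq k (j, 1)))) (g j)) := by
    intro i
    have e : (A * X * Bᵀ - B * Xᵀ * Aᵀ).submatrix i.succAbove i.succAbove =
      (A * X * Bᵀ).submatrix i.succAbove i.succAbove - ((A * X * Bᵀ).submatrix i.succAbove i.succAbove)ᵀ := by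
      have : B * Xᵀ * Aᵀ = (A * X * Bᵀ)ᵀ := by
        simp [Matrix.transpose_mul, Matrix.mul_assoc]
      rw [this]; rfl
    have hz : ∀ p q, (A * X * Bᵀ) p q = ∑ c, ∑ d, X c d * (A p c * B q d) := by
      intro p q
      simp only [Matrix.mul_apply, Finset.sum_mul, Matrix.transpose_apply]
      rw [Finset.sum_comm]
      exact Finset.sum_congr rfl fun _ _ => Finset.sum_congr rfl fun _ _ => by ring
    rw [e, pf_fact]
    simp only [Matrix.submatrix_apply, hz]
    simp only [Finset.prod_univ_sum, Fintype.piFinset_univ, Finset.prod_mul_distrib, Finset.mul_sum]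
    rw [Finset.sum_comm]
    refine Finset.sum_congr rfl fun f _ => ?_
    rw [Finset.sum_comm]
    refine Finset.sum_congr rfl fun g _ => ?_
    refine Finset.sum_congr rfl fun σ _ => ?_
    ring
  have e1 : ∀ G : (Fin (k+1) → Fin n) → R, ∑ F, G F = ∑ c : Fin n, ∑ f : Fin k → Fin n, G (Fin.cons c f) := by
    intro G
    rw [← Fintype.sum_prod_type', ← (Fin.consEquiv (fun _ : Fin (k+1) => Fin n)).sum_comp]
    rfl
  rw [e1]
  simp only [Fin.cons_succ]
  calc _ = ∑ i : Fin (2*k+1), ∑ c : Fin n, ∑ f : Fin k → Fin n, ∑ g : Fin k → Fin n,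
        (∏ j, X (f j) (g j)) * ((-1 : R)^(i:ℕ) * A i c * ∑ σ : Equiv.Perm (Fin (2*k)), ((Equiv.Perm.sign σ : ℤ) : R) *
        ∏ j : Fin k, (A (i.succAbove (σ (prEq k (j, 0)))) (f j) * B (i.succAbove (σ (prEq k (j, 1)))) (g j))) := by
        rw [Finset.mul_sum]
        refine Finset.sum_congr rfl fun i _ => ?_
        rw [mul_left_comm, hZ, mul_assoc, Finset.sum_mul, Finset.mul_sum]
        refine Finset.sum_congr rfl fun c _ => ?_
        rw [← mul_assoc, Finset.mul_sum]
        refine Finset.sum_congr rfl fun f _ => ?_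
        rw [Finset.mul_sum]
        refine Finset.sum_congr rfl fun g _ => ?_
        ring
    _ = _ := by
        rw [Finset.sum_comm, Finset.mul_sum]
        refine Finset.sum_congr rfl fun c _ => ?_
        rw [Finset.sum_comm, Finset.mul_sum]
        refine Finset.sum_congr rfl fun f _ => ?_
        rw [Finset.sum_comm, Finset.mul_sum]
        refine Finset.sum_congr rfl fun g _ => ?_
        rw [← Finset.mul_sum, laplace_step]
        ring

theorem sum_incr {M : Type*} [AddCommMonoid M] (k n : ℕ) (φ : (Fin k → Fin n) → M)
    (h : ∀ f, ¬ Function.Injective f → φ f = 0) :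
    ∑ f, φ f = ∑ f ∈ incrFuns k n, ∑ τ : Equiv.Perm (Fin k), φ (f ∘ τ) := by
  classical
  have : ∑ f, φ f = ∑ f ∈ Finset.univ.filter (fun f : Fin k → Fin n => Function.Injective f), φ f := by
    symm
    apply Finset.sum_subset (Finset.filter_subset _ _)
    intro f _ hf
    exact h f (by simpa using hf)
  rw [this, ← Finset.sum_product']
  symm
  have hin : ∀ f, f ∈ incrFuns k n ↔ StrictMono f := by
    intro f; simp [incrFuns, StrictMono]
  refine Finset.sum_bij (fun x _ => x.1 ∘ x.2) ?_ ?_ ?_ (by simp)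
  · rintro ⟨f, τ⟩ hx
    simp [hin] at hx
    simpa using hx.injective
  · rintro ⟨f, τ⟩ hx ⟨f', τ'⟩ hx' e
    simp [hin] at hx hx' e
    have : f = f' := by
      apply (hx.range_inj hx').1
      rw [← τ.surjective.range_comp f, e, τ'.surjective.range_comp]
    subst this
    have : τ = τ' := by
      ext1 i
      exact hx.injective (congrFun e i)
    rw [this]
  · intro f hf
    simp at hf
    refine ⟨⟨f ∘ Tuple.sort f, (Tuple.sort f)⁻¹⟩, ?_, ?_⟩
    · simp [hin]
      exact (Tuple.monotone_sort f).strictMono_of_injective (hf.comp (Tuple.sort f).injective)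
    · funext i; simp

theorem det_concat_perm {R : Type*} [CommRing R] {k n : ℕ} (A B : Matrix (Fin (2*k+1)) (Fin n) R)
    (F : Fin (k+1) → Fin n) (g : Fin k → Fin n) (τ : Equiv.Perm (Fin (k+1))) (ρ : Equiv.Perm (Fin k)) :
    (concatCBodd A B (F ∘ τ) (g ∘ ρ)).det =
      ((Equiv.Perm.sign τ : ℤ) : R) * ((Equiv.Perm.sign ρ : ℤ) : R) * (concatCBodd A B F g).det := by
  have h := Matrix.det_permute' ((cs k).permCongr (Equiv.sumCongr τ ρ)) (concatCBodd A B F g)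
  rw [Equiv.Perm.sign_permCongr] at h
  have h2 := Equiv.Perm.sign_sumCongr τ ρ
  rw [Equiv.Perm.sumCongr] at h2
  rw [h2] at h
  push_cast at h
  rw [← h]
  congr 1
  ext i j
  obtain ⟨s, rfl⟩ := (cs k).surjective j
  rcases s with a | a <;> simp [concat_inl, concat_inr, Equiv.permCongr_apply]

theorem oneCol_zero {R : Type*} [CommRing R] {k n : ℕ} (X : Matrix (Fin n) (Fin n) R)
    (F : Fin (k+1) → Fin n) (g : Fin k → Fin n) (i) : oneCol X F g i 0 = 1 := by simp [oneCol]

theorem oneCol_succ {R : Type*} [CommRing R] {k n : ℕ} (X : Matrix (Fin n) (Fin n) R)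
    (F : Fin (k+1) → Fin n) (g : Fin k → Fin n) (i) (j : Fin k) :
    oneCol X F g i j.succ = X (F i) (g j) := by simp [oneCol]

theorem sum_oneCol {R : Type*} [CommRing R] {k n : ℕ} (X : Matrix (Fin n) (Fin n) R)
    (F : Fin (k+1) → Fin n) (g : Fin k → Fin n) :
    ∑ τ : Equiv.Perm (Fin (k+1)), ((Equiv.Perm.sign τ : ℤ) : R) * ∏ j : Fin k, X (F (τ j.succ)) (g j)
      = (oneCol X F g).det := by
  rw [Matrix.det_apply']
  refine Finset.sum_congr rfl fun τ _ => ?_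
  rw [Fin.prod_univ_succ]
  simp [oneCol_zero, oneCol_succ]

theorem oneCol_perm {R : Type*} [CommRing R] {k n : ℕ} (X : Matrix (Fin n) (Fin n) R)
    (F : Fin (k+1) → Fin n) (g : Fin k → Fin n) (ρ : Equiv.Perm (Fin k)) :
    (oneCol X F (g ∘ ρ)).det = ((Equiv.Perm.sign ρ : ℤ) : R) * (oneCol X F g).det := by
  have h := Matrix.det_permute' (Equiv.Perm.decomposeFin.symm (0, ρ)) (oneCol X F g)
  rw [Equiv.Perm.decomposeFin.symm_sign, if_pos rfl, one_mul] at h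
  rw [← h]
  congr 1
  ext i j
  refine Fin.cases ?_ (fun j => ?_) j
  · simp [oneCol_zero]
  · simp [oneCol_succ]

theorem collect_step {R : Type*} [CommRing R] {k n : ℕ} (A B : Matrix (Fin (2*k+1)) (Fin n) R)
    (X : Matrix (Fin n) (Fin n) R) :
    ∑ F : Fin (k+1) → Fin n, ∑ g : Fin k → Fin n,
      (∏ j : Fin k, X (F j.succ) (g j)) * (concatCBodd A B F g).det = (k.factorial : R) * gAB A B X := by
  have zF : ∀ F : Fin (k+1) → Fin n, ¬ Function.Injective F → ∀ g : Fin k → Fin n, (concatCBodd A B F g).det = 0 := by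
    intro F hF g
    simp only [Function.Injective, not_forall] at hF
    obtain ⟨a, b, hab, hne⟩ := hF
    apply Matrix.det_zero_of_column_eq (i := cs k (Sum.inl a)) (j := cs k (Sum.inl b)) (by simpa using hne)
    intro i
    rw [concat_inl, concat_inl, hab]
  have zg : ∀ g : Fin k → Fin n, ¬ Function.Injective g → ∀ F : Fin (k+1) → Fin n, (concatCBodd A B F g).det = 0 := by
    intro g hg F
    simp only [Function.Injective, not_forall] at hg
    obtain ⟨a, b, hab, hne⟩ := hg
    apply Matrix.det_zero_of_column_eq (i := cs k (Sum.inr a)) (j := cs k (Sum.inr b)) (by simpa using hne)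
    intro i
    rw [concat_inr, concat_inr, hab]
  rw [sum_incr]
  swap
  · intro F hF
    exact Finset.sum_eq_zero fun g _ => by rw [zF F hF, mul_zero]
  rw [gAB, Finset.mul_sum]
  refine Finset.sum_congr rfl fun F _ => ?_
  rw [Finset.sum_congr rfl (fun τ _ => sum_incr k n _ (fun g hg => by rw [zg g hg, mul_zero]))]
  rw [Finset.sum_comm, Finset.mul_sum]
  refine Finset.sum_congr rfl fun g _ => ?_
  rw [Finset.sum_comm]
  have : ∀ ρ : Equiv.Perm (Fin k), ∑ τ : Equiv.Perm (Fin (k+1)),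
      (∏ j : Fin k, X ((F ∘ τ) j.succ) ((g ∘ ρ) j)) * (concatCBodd A B (F ∘ τ) (g ∘ ρ)).det =
      (oneCol X F g).det * (concatCBodd A B F g).det := by
    intro ρ
    have hs : ((Equiv.Perm.sign ρ : ℤ) : R) * ((Equiv.Perm.sign ρ : ℤ) : R) = 1 := by
      rw [← Int.cast_mul, ← Units.val_mul, Int.units_mul_self]; simp
    calc _ = (oneCol X F (g ∘ ρ)).det * (((Equiv.Perm.sign ρ : ℤ) : R) * (concatCBodd A B F g).det) := by
          rw [← sum_oneCol, Finset.sum_mul]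
          refine Finset.sum_congr rfl fun τ _ => ?_
          rw [det_concat_perm]
          simp only [Function.comp]
          ring
      _ = _ := by
          rw [oneCol_perm]
          linear_combination ((oneCol X F g).det * (concatCBodd A B F g).det) * hs
  rw [Finset.sum_congr rfl (fun ρ _ => this ρ)]
  simp [Fintype.card_perm]

theorem pf_domain {R : Type*} [CommRing R] [IsDomain R] [CharZero R] (k n : ℕ)
    (A B : Matrix (Fin (2*k+1)) (Fin n) R) (X : Matrix (Fin n) (Fin n) R) :
    (∑ i : Fin (2*k+1),
        (-1 : R)^(i:ℕ) * (∑ j : Fin n, A i j) *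
          pfaffian ((A * X * Bᵀ - B * Xᵀ * Aᵀ).submatrix i.succAbove i.succAbove))
      = (-1 : R)^(Nat.choose k 2) * gAB A B X := by
  have h := expand_step A B X
  rw [collect_step] at h
  have hk : (k.factorial : R) ≠ 0 := by exact_mod_cast k.factorial_ne_zero
  apply mul_left_cancel₀ hk
  rw [h]; ring

theorem map_pf {R S : Type*} [CommRing R] [CommRing S] (φ : R →+* S) {k : ℕ}
    (Y : Matrix (Fin (2*k)) (Fin (2*k)) R) : φ (pfaffian Y) = pfaffian (Y.map φ) := by
  simp [pfaffian, map_sum, map_prod]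

theorem map_gAB {R S : Type*} [CommRing R] [CommRing S] (φ : R →+* S) {k n : ℕ}
    (A B : Matrix (Fin (2*k+1)) (Fin n) R) (X : Matrix (Fin n) (Fin n) R) :
    φ (gAB A B X) = gAB (A.map φ) (B.map φ) (X.map φ) := by
  have h1 : ∀ (F : Fin (k+1) → Fin n) (g : Fin k → Fin n), (oneCol X F g).map φ = oneCol (X.map φ) F g := by
    intro F g; ext i j
    simp only [oneCol, Matrix.map_apply, Matrix.of_apply]
    split_ifs <;> simp
  have h2 : ∀ (F : Fin (k+1) → Fin n) (g : Fin k → Fin n), (concatCBodd A B F g).map φ = concatCBodd (A.map φ) (B.map φ) F g := by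
    intro F g; ext i j
    simp only [concatCBodd, Matrix.map_apply, Matrix.of_apply]
    split_ifs <;> simp
  simp only [gAB, map_sum, map_mul, RingHom.map_det, RingHom.mapMatrix_apply, h1, h2]

/-- Lemma: for `m = 2k+1` odd and `Y = A·X·Bᵗ − B·Xᵗ·Aᵗ`,
`Σ_{i=1}^m (−1)^{i−1} (Σ_j A_{i,j}) Pf(Y(i)) = (−1)^{binom((m−1)/2,2)} g_{A,B}(X)`,
where `Y(i)` arises from `Y` by deleting the `i`-th row and column.
(In 0-based indexing the sign `(−1)^{i−1}` of the 1-based statement becomes `(−1)^i`.) -/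
theorem pf_expansion_odd {R : Type*} [CommRing R] (k n : ℕ) (hn : 0 < n)
    (A B : Matrix (Fin (2*k+1)) (Fin n) R) (X : Matrix (Fin n) (Fin n) R) :
    (∑ i : Fin (2*k+1),
        (-1 : R)^(i:ℕ) * (∑ j : Fin n, A i j) *
          pfaffian ((A * X * Bᵀ - B * Xᵀ * Aᵀ).submatrix i.succAbove i.succAbove))
      = (-1 : R)^(Nat.choose k 2) * gAB A B X := by
  let V := (Fin (2*k+1) × Fin n) ⊕ (Fin (2*k+1) × Fin n) ⊕ (Fin n × Fin n)
  let v : V → R := Sum.elim (fun x => A x.1 x.2) (Sum.elim (fun x => B x.1 x.2) (fun x => X x.1 x.2))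
  let φ : MvPolynomial V ℤ →+* R := MvPolynomial.eval₂Hom (Int.castRingHom R) v
  let A' : Matrix (Fin (2*k+1)) (Fin n) (MvPolynomial V ℤ) :=
    Matrix.of fun i j => MvPolynomial.X (Sum.inl (i, j))
  let B' : Matrix (Fin (2*k+1)) (Fin n) (MvPolynomial V ℤ) :=
    Matrix.of fun i j => MvPolynomial.X (Sum.inr (Sum.inl (i, j)))
  let X' : Matrix (Fin n) (Fin n) (MvPolynomial V ℤ) :=
    Matrix.of fun i j => MvPolynomial.X (Sum.inr (Sum.inr (i, j)))
  have hA : A'.map φ = A := by ext i j; simp [A', φ, v]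
  have hB : B'.map φ = B := by ext i j; simp [B', φ, v]
  have hX : X'.map φ = X := by ext i j; simp [X', φ, v]
  have h := congrArg φ (pf_domain k n A' B' X')
  rw [map_mul, map_gAB, hA, hB, hX] at h
  rw [map_pow, map_neg, map_one] at h
  rw [← h, map_sum]
  refine Finset.sum_congr rfl fun i _ => ?_
  rw [map_mul, map_mul, map_pow, map_neg, map_one, map_sum, map_pf]
  have hA' : ∀ j, φ (A' i j) = A i j := fun j => by rw [← hA]; rfl
  have hY : ((A' * X' * B'ᵀ - B' * X'ᵀ * A'ᵀ).submatrix i.succAbove i.succAbove).map φ =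
      (A * X * Bᵀ - B * Xᵀ * Aᵀ).submatrix i.succAbove i.succAbove := by
    rw [← Matrix.submatrix_map, Matrix.map_sub φ (map_sub φ), Matrix.map_mul, Matrix.map_mul, Matrix.map_mul,
      Matrix.map_mul, Matrix.transpose_map, Matrix.transpose_map, Matrix.transpose_map, hA, hB, hX]
  rw [hY]
  simp only [hA']
end

section
/- Let Y be a skew-symmetric m×m matrix over a commutative ring with m even, and let M = (a_i·a_j)_{1≤i,j≤m} be a symmetric rank-1 matrix given by elements a_1,…,a_m. Then det(Y + M) = Pf(Y)² = det(Y). -/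
open Matrix

namespace PfAux

/-- block indexing -/
def ee (k : ℕ) : Fin k × Bool ≃ Fin (2*k) where
  toFun x := ⟨2*(x.1:ℕ) + (if x.2 then 1 else 0), by have := x.1.isLt; split <;> omega⟩
  invFun j := (⟨(j:ℕ)/2, by have := j.isLt; omega⟩, decide ((j:ℕ) % 2 = 1))
  left_inv := by
    rintro ⟨⟨i, hi⟩, b⟩
    cases b <;> simp <;> omega
  right_inv := by
    rintro ⟨j, hj⟩
    ext
    by_cases h : j % 2 = 1 <;> simp [h] <;> omega

variable {R : Type*} [CommRing R] {k : ℕ}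

/-- weight -/
def w (Y : Matrix (Fin k × Bool) (Fin k × Bool) R) (σ : Equiv.Perm (Fin k × Bool)) : R :=
  ((Equiv.Perm.sign σ : ℤ) : R) * ∏ i : Fin k, Y (σ (i, false)) (σ (i, true))

/-- normal form -/
def NF (σ : Equiv.Perm (Fin k × Bool)) : Prop :=
  (∀ i, ee k (σ (i, false)) < ee k (σ (i, true))) ∧
  (∀ i j, i < j → ee k (σ (i, false)) < ee k (σ (j, false)))

instance : DecidablePred (NF (k := k)) := fun σ => by unfold NF; infer_instance

/-- full sum -/
def pf' (Y : Matrix (Fin k × Bool) (Fin k × Bool) R) : R := ∑ σ, w Y σ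

lemma pfaffian_eq (Y : Matrix (Fin (2*k)) (Fin (2*k)) R) :
    pfaffian Y = ∑ σ ∈ Finset.univ.filter (NF (k := k)), w (Y.submatrix (ee k) (ee k)) σ := by
  symm
  unfold pfaffian
  refine Finset.sum_equiv (ee k).permCongr ?_ ?_
  · intro σ
    simp only [Finset.mem_filter, Finset.mem_univ, true_and, NF]
    have h0 : ∀ i : Fin k, (ee k).symm ⟨2*(i:ℕ), by have := i.isLt; omega⟩ = (i, false) := by
      intro i; rw [Equiv.symm_apply_eq]; simp [ee]
    have h1 : ∀ i : Fin k, (ee k).symm ⟨2*(i:ℕ)+1, by have := i.isLt; omega⟩ = (i, true) := by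
      intro i; rw [Equiv.symm_apply_eq]; simp [ee]
    simp only [Equiv.permCongr_apply, h0, h1]
  · intro σ _
    have h0 : ∀ i : Fin k, (ee k).symm ⟨2*(i:ℕ), by have := i.isLt; omega⟩ = (i, false) := by
      intro i; rw [Equiv.symm_apply_eq]; simp [ee]
    have h1 : ∀ i : Fin k, (ee k).symm ⟨2*(i:ℕ)+1, by have := i.isLt; omega⟩ = (i, true) := by
      intro i; rw [Equiv.symm_apply_eq]; simp [ee]
    simp only [Equiv.permCongr_apply, h0, h1, w, Equiv.Perm.sign_permCongr, submatrix_apply]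

/-- hyperoctahedral element -/
def g (x : (Fin k → Bool) × Equiv.Perm (Fin k)) : Equiv.Perm (Fin k × Bool) :=
  (Equiv.prodCongrRight fun i => if x.1 i then Equiv.swap false true else 1) *
    Equiv.prodCongrLeft (fun _ => x.2)

lemma g_apply (x : (Fin k → Bool) × Equiv.Perm (Fin k)) (i : Fin k) (b : Bool) :
    g x (i, b) = (x.2 i, xor b (x.1 (x.2 i))) := by
  unfold g
  cases h : x.1 (x.2 i) <;> cases b <;> simp [h]

lemma sign_g (x : (Fin k → Bool) × Equiv.Perm (Fin k)) :
    Equiv.Perm.sign (g x) = ∏ i, if x.1 i then -1 else 1 := by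
  unfold g
  rw [Equiv.Perm.sign_mul, Equiv.Perm.sign_prodCongrRight, Equiv.Perm.sign_prodCongrLeft]
  have : ∏ _b : Bool, Equiv.Perm.sign x.2 = 1 := by
    simp
  rw [this, mul_one]
  refine Finset.prod_congr rfl fun i _ => ?_
  cases x.1 i <;> simp [Equiv.Perm.sign_swap]

lemma w_g (Y : Matrix (Fin k × Bool) (Fin k × Bool) R) (hY : ∀ i j, Y j i = - Y i j)
    (σ : Equiv.Perm (Fin k × Bool)) (x : (Fin k → Bool) × Equiv.Perm (Fin k)) :
    w Y (σ * g x) = w Y σ := by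
  unfold w
  have h1 : ∏ i, Y ((σ * g x) (i, false)) ((σ * g x) (i, true)) =
      ∏ i, ((if x.1 i then -1 else 1) * Y (σ (i, false)) (σ (i, true))) := by
    rw [← Equiv.prod_comp x.2 (fun i => ((if x.1 i then -1 else 1) * Y (σ (i, false)) (σ (i, true))))]
    refine Finset.prod_congr rfl fun i _ => ?_
    simp only [Equiv.Perm.mul_apply, g_apply]
    cases x.1 (x.2 i)
    · simp
    · simp [hY (σ (x.2 i, false)) (σ (x.2 i, true))]
  rw [h1, Finset.prod_mul_distrib, Equiv.Perm.sign_mul, sign_g]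
  have h2 : (((∏ i, if x.1 i then (-1 : ℤˣ) else 1 : ℤˣ) : ℤ) : R) = ∏ i, if x.1 i then (-1:R) else 1 := by
    push_cast [Units.coe_prod]
    refine Finset.prod_congr rfl fun i _ => ?_
    split <;> simp
  have h3 : (∏ i, if x.1 i then (-1:R) else 1) * (∏ i, if x.1 i then (-1:R) else 1) = 1 := by
    rw [← Finset.prod_mul_distrib]
    refine Finset.prod_eq_one fun i _ => ?_
    split <;> simp
  rw [Units.val_mul, Int.cast_mul, h2]
  linear_combination (((Equiv.Perm.sign σ : ℤ) : R) * ∏ i : Fin k, Y (σ (i, false)) (σ (i, true))) * h3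

lemma exists_unique_g (σ : Equiv.Perm (Fin k × Bool)) : ∃! x, NF (σ * g x) := by
  let ε : Fin k → Bool := fun i => decide (ee k (σ (i, true)) < ee k (σ (i, false)))
  let m : Fin k → Fin (2*k) := fun i => ee k (σ (i, ε i))
  have hm : Function.Injective m := by
    intro i j h
    have := σ.injective ((ee k).injective h)
    exact (Prod.mk.inj this).1
  have hne : ∀ i, ee k (σ (i, false)) ≠ ee k (σ (i, true)) := by
    intro i h
    have := σ.injective ((ee k).injective h)
    simp at this
  refine ⟨(ε, Tuple.sort m), ⟨?_, ?_⟩, ?_⟩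
  · intro i
    simp only [Equiv.Perm.mul_apply, g_apply]
    generalize Tuple.sort m i = j
    have := hne j
    by_cases h : ee k (σ (j, true)) < ee k (σ (j, false))
    · simp [ε, h]
    · simp [ε, h]
      exact lt_of_le_of_ne (not_lt.1 h) this
  · intro i j hij
    have hs : StrictMono (m ∘ Tuple.sort m) :=
      (Tuple.monotone_sort m).strictMono_of_injective (hm.comp (Tuple.sort m).injective)
    have := hs hij
    simp only [Equiv.Perm.mul_apply, g_apply, Bool.false_xor]
    exact this
  · rintro ⟨ε', π⟩ ⟨h1, h2⟩
    have hε : ε' = ε := by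
      funext j
      have := h1 (π.symm j)
      simp only [Equiv.Perm.mul_apply, g_apply, Equiv.apply_symm_apply] at this
      cases h : ε' j
      · simp [h] at this
        simp [ε, this.le]
      · simp [h] at this
        simp [ε, this]
    subst hε
    have hmono : Monotone (m ∘ π) := by
      refine StrictMono.monotone fun i j hij => ?_
      have := h2 i j hij
      simp only [Equiv.Perm.mul_apply, g_apply, Bool.false_xor] at this
      exact this
    have := Tuple.unique_monotone hmono (Tuple.monotone_sort m)
    congr 1
    ext i
    exact congrArg Fin.val (hm (congrFun this i))

lemma pf'_eq (Y : Matrix (Fin k × Bool) (Fin k × Bool) R) (hY : ∀ i j, Y j i = - Y i j) :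
    pf' Y = (Fintype.card ((Fin k → Bool) × Equiv.Perm (Fin k)) : R) *
      ∑ σ ∈ Finset.univ.filter (NF (k := k)), w Y σ := by
  have h1 : ∀ x : (Fin k → Bool) × Equiv.Perm (Fin k),
      ∑ σ ∈ Finset.univ.filter (NF (k := k)), w Y σ =
        ∑ σ, if NF (σ * g x) then w Y σ else 0 := by
    intro x
    rw [Finset.sum_filter, ← Equiv.sum_comp (Equiv.mulRight (g x))]
    refine Finset.sum_congr rfl fun σ _ => ?_
    simp only [Equiv.coe_mulRight, w_g Y hY]
  have h2 : (Fintype.card ((Fin k → Bool) × Equiv.Perm (Fin k)) : R) *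
      ∑ σ ∈ Finset.univ.filter (NF (k := k)), w Y σ =
      ∑ x : (Fin k → Bool) × Equiv.Perm (Fin k), ∑ σ, if NF (σ * g x) then w Y σ else 0 := by
    rw [← Finset.sum_congr rfl (fun x _ => h1 x), Finset.sum_const, nsmul_eq_mul, Finset.card_univ]
  rw [h2, Finset.sum_comm]
  unfold pf'
  refine Finset.sum_congr rfl fun σ _ => ?_
  obtain ⟨x, hx, hu⟩ := exists_unique_g σ
  rw [Finset.sum_eq_single x]
  · simp [hx]
  · intro y _ hy
    rw [if_neg]
    exact fun h => hy (hu y h)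
  · simp

lemma det_sub_zero {n : Type*} [Fintype n] [DecidableEq n] (B : Matrix n n R) (f : n → n)
    (hf : ¬ Function.Bijective f) : (B.submatrix id f).det = 0 := by
  rw [← Finite.injective_iff_bijective, Function.Injective] at hf
  push Not at hf
  obtain ⟨i, j, h, hij⟩ := hf
  exact det_zero_of_column_eq hij (fun r => by simp [h])

lemma pf'_congr (B X : Matrix (Fin k × Bool) (Fin k × Bool) R) :
    pf' (B * X * Bᵀ) = B.det * pf' X := by
  have h0 : ∀ r s, (B * X * Bᵀ) r s = ∑ p : Bool → Fin k × Bool,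
      X (p false) (p true) * (B r (p false) * B s (p true)) := by
    intro r s
    rw [← Equiv.sum_comp (Equiv.boolArrowEquivProd (Fin k × Bool)).symm, Fintype.sum_prod_type,
      Finset.sum_comm]
    simp only [mul_apply, transpose_apply, Finset.sum_mul]
    refine Finset.sum_congr rfl fun x _ => Finset.sum_congr rfl fun y _ => ?_
    simp [Equiv.boolArrowEquivProd]
    ring
  have h1 : pf' (B * X * Bᵀ) = ∑ f : Fin k × Bool → Fin k × Bool,
      (∏ i, X (f (i, false)) (f (i, true))) * (B.submatrix id f).det := by
    unfold pf' w
    simp only [h0, Finset.prod_univ_sum, Finset.mul_sum, Fintype.piFinset_univ]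
    rw [Finset.sum_comm, ← Equiv.sum_comp (Equiv.curry (Fin k) Bool (Fin k × Bool))]
    refine Finset.sum_congr rfl fun f _ => ?_
    rw [det_apply', Finset.mul_sum]
    refine Finset.sum_congr rfl fun σ _ => ?_
    simp only [Finset.prod_mul_distrib, Equiv.curry_apply, Function.curry, submatrix_apply, id,
      Fintype.prod_prod_type, Fintype.prod_bool]
    ring
  have h2 : ∑ f : Fin k × Bool → Fin k × Bool,
      (∏ i, X (f (i, false)) (f (i, true))) * (B.submatrix id f).det =
      ∑ σ : Equiv.Perm (Fin k × Bool),
      (∏ i, X (σ (i, false)) (σ (i, true))) * (B.submatrix id σ).det := by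
    symm
    refine Finset.sum_of_injOn (fun σ => ⇑σ) (fun a _ b _ h => DFunLike.coe_injective h)
      (fun _ _ => Finset.mem_coe.2 (Finset.mem_univ _)) ?_ (fun _ _ => rfl)
    intro f _ hf
    rw [det_sub_zero, mul_zero]
    intro hb
    exact hf ⟨Equiv.ofBijective f hb, by simp, rfl⟩
  rw [h1, h2]
  unfold pf' w
  rw [Finset.mul_sum]
  refine Finset.sum_congr rfl fun σ _ => ?_
  rw [det_permute']
  ring

/-- standard form -/
def J (R : Type*) [CommRing R] (k : ℕ) : Matrix (Fin k × Bool) (Fin k × Bool) R :=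
  Matrix.of fun x y => if x.1 = y.1 then (if x.2 = y.2 then 0 else if y.2 then 1 else -1) else 0

lemma J_skew (x y : Fin k × Bool) : J R k y x = - J R k x y := by
  obtain ⟨i, b⟩ := x
  obtain ⟨j, c⟩ := y
  by_cases h : i = j
  · subst h; cases b <;> cases c <;> simp [J]
  · simp [J, h, Ne.symm h]

lemma J_pf : ∑ σ ∈ Finset.univ.filter (NF (k := k)), w (J R k) σ = 1 := by
  rw [Finset.sum_eq_single 1]
  · simp [w, J]
  · intro σ hσ hne
    obtain ⟨h1, h2⟩ := (Finset.mem_filter.1 hσ).2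
    by_contra h0
    apply hne
    have hJ : ∀ i, J R k (σ (i, false)) (σ (i, true)) ≠ 0 := by
      intro i hi
      apply h0
      unfold w
      rw [Finset.prod_eq_zero (Finset.mem_univ i) hi, mul_zero]
    have hs : ∀ i, (σ (i, false)).2 = false ∧ σ (i, true) = ((σ (i, false)).1, true) := by
      intro i
      have a := hJ i
      have b := h1 i
      revert a b
      generalize σ (i, false) = x
      generalize σ (i, true) = y
      obtain ⟨x, c⟩ := x
      obtain ⟨y, d⟩ := y
      intro a b
      have hxy : x = y := by by_contra h; simp [J, h] at a
      subst hxy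
      cases c <;> cases d <;> simp [J, ee] at a b ⊢
    have hmono : StrictMono (fun i => (σ (i, false)).1) := by
      intro i j hij
      have := h2 i j hij
      have a := (hs i).1
      have b := (hs j).1
      simp only [ee, Equiv.coe_fn_mk, a, b, Fin.lt_def] at this ⊢
      simp at this
      exact this
    have hid : ∀ i, (σ (i, false)).1 = i := by
      have : (fun i => (σ (i, false)).1) = id := by
        refine (StrictMono.range_inj hmono strictMono_id).1 ?_
        rw [Set.range_id]
        exact (Finite.injective_iff_surjective.1 hmono.injective).range_eq
      exact fun i => congrFun this i
    ext1 ⟨i, b⟩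
    cases b
    · exact Prod.ext (hid i) (hs i).1
    · rw [(hs i).2, hid i]; rfl
  · intro h
    exfalso
    apply h
    simp [NF, ee]

lemma J_det : (J R k).det = 1 := by
  let M : Matrix Bool Bool R := Matrix.of fun x y => if x = y then 0 else if y then 1 else -1
  have hM : M.det = 1 := by
    rw [← det_submatrix_equiv_self finTwoEquiv, det_fin_two]
    simp [M, finTwoEquiv]
  have : J R k = (blockDiagonal (fun _ : Fin k => M)).submatrix
      (Equiv.prodComm (Fin k) Bool) (Equiv.prodComm (Fin k) Bool) := by
    ext ⟨i, b⟩ ⟨j, c⟩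
    simp [J, M, blockDiagonal_apply]
  rw [this, det_submatrix_equiv_self, det_blockDiagonal]
  simp [hM]

lemma wedge {K : Type*} [Field K] {n : Type*} [DecidableEq n] : ∀ (k : ℕ) (Y : Matrix n n K),
    (∀ i j, Y j i = - Y i j) → (∀ i, Y i i = 0) → ∀ S : Finset n, S.card ≤ 2*k →
    (∀ i, i ∉ S → ∀ j, Y i j = 0) →
    ∃ u v : Fin k → n → K, ∀ r s, Y r s = ∑ i, (u i r * v i s - v i r * u i s) := by
  intro k
  induction k with
  | zero =>
    intro Y _ _ S hS h
    have : S = ∅ := by simpa using hS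
    subst this
    exact ⟨fun _ _ => 0, fun _ _ => 0, fun r s => by simp [h]⟩
  | succ k ih =>
    intro Y hsk hd S hS h
    by_cases h0 : ∀ i j, Y i j = 0
    · exact ⟨fun _ _ => 0, fun _ _ => 0, fun r s => by simp [h0]⟩
    push Not at h0
    obtain ⟨p, q, hpq⟩ := h0
    have hne : p ≠ q := by rintro rfl; exact hpq (hd p)
    have hp : p ∈ S := by by_contra hc; exact hpq (h p hc q)
    have hq : q ∈ S := by
      by_contra hc
      apply hpq
      rw [hsk q p, h q hc p, neg_zero]
    let Y' : Matrix n n K := Matrix.of fun i j => Y i j - ((Y p q)⁻¹ * Y i q * Y p j - Y p i * ((Y p q)⁻¹ * Y j q))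
    obtain ⟨u, v, huv⟩ := ih Y' (by
        intro i j
        simp only [Y', of_apply]
        rw [hsk i j]
        ring) (by
        intro i
        simp only [Y', of_apply]
        rw [hd i]
        ring) ((S.erase p).erase q) (by
        rw [Finset.card_erase_of_mem (Finset.mem_erase.2 ⟨hne.symm, hq⟩),
          Finset.card_erase_of_mem hp]
        omega) (by
        intro i hi j
        simp only [Finset.mem_erase, not_and] at hi
        simp only [Y', of_apply]
        by_cases hiq : i = q
        · subst hiq
          rw [hd, hsk j i]
          field_simp
          ring
        by_cases hip : i = p
        · subst hip
          rw [hd]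
          field_simp
          ring
        have hiS := hi hiq hip
        rw [hsk i p, h i hiS, h i hiS, h i hiS]
        ring)
    refine ⟨Fin.cons (fun i => (Y p q)⁻¹ * Y i q) u, Fin.cons (fun i => Y p i) v, ?_⟩
    intro r s
    rw [Fin.sum_univ_succ]
    simp only [Fin.cons_zero, Fin.cons_succ]
    rw [← huv]
    simp only [Y', of_apply]
    ring

lemma field_case {K : Type*} [Field K] [CharZero K]
    (Y : Matrix (Fin (2*k)) (Fin (2*k)) K)
    (hsk : ∀ i j, Y j i = - Y i j) (hd : ∀ i, Y i i = 0) : pfaffian Y ^ 2 = Y.det := by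
  obtain ⟨u, v, huv⟩ := wedge k (Y.submatrix (ee k) (ee k)) (fun i j => hsk _ _) (fun i => hd _)
    Finset.univ (by simp [mul_comm]) (by simp)
  let B : Matrix (Fin k × Bool) (Fin k × Bool) K := Matrix.of fun r x => if x.2 then v x.1 r else u x.1 r
  have hB : Y.submatrix (ee k) (ee k) = B * J K k * Bᵀ := by
    ext r s
    rw [huv]
    simp only [mul_apply, transpose_apply, Fintype.sum_prod_type, Fintype.sum_bool, B, J, of_apply]
    refine Finset.sum_congr rfl fun i _ => ?_
    simp
    ring
  have h1 := pf'_eq (Y.submatrix (ee k) (ee k)) (fun i j => hsk _ _)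
  have h2 := pf'_eq (J K k) J_skew
  rw [J_pf, mul_one] at h2
  rw [← pfaffian_eq, hB, pf'_congr, h2] at h1
  have hc : (Fintype.card ((Fin k → Bool) × Equiv.Perm (Fin k)) : K) ≠ 0 :=
    Nat.cast_ne_zero.2 Fintype.card_ne_zero
  have h3 : pfaffian Y = B.det := by
    apply mul_left_cancel₀ hc
    rw [← h1, mul_comm]
  rw [h3, ← det_submatrix_equiv_self (ee k) Y, hB, det_mul, det_mul, det_transpose, J_det]
  ring

lemma det_rank_one {n : Type*} [Fintype n] [DecidableEq n] (Y : Matrix n n R) (a : n → R) :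
    (Y + Matrix.of fun i j => a i * a j).det + (Y - Matrix.of fun i j => a i * a j).det
      = 2 * Y.det := by
  let A : Matrix n Unit R := Matrix.of fun i _ => a i
  let M : Matrix (n ⊕ Unit) (n ⊕ Unit) R := fromBlocks Y (-A) 0 1
  have key : ∀ (c : n → R) (t : R), M.updateRow (Sum.inr ()) (Sum.elim c fun _ => t) =
      fromBlocks Y (-A) (Matrix.of fun _ j => c j) (Matrix.of fun _ _ => t) := by
    intro c t
    ext (i | i) (j | j) <;> simp [M, updateRow_apply]
  have one : (Matrix.of fun _ _ => 1 : Matrix Unit Unit R) = 1 := by ext; simp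
  have d : ∀ c : n → R, (M.updateRow (Sum.inr ()) (Sum.elim c fun _ => 1)).det =
      (Y + Matrix.of fun i j => a i * c j).det := by
    intro c
    rw [key, one, det_fromBlocks_one₂₂]
    congr 1
    ext i j
    simp [A, mul_apply]
  have e1 : (Y - Matrix.of fun i j => a i * a j) = (Y + Matrix.of fun i j => a i * (-a) j) := by
    ext i j; simp [sub_eq_add_neg]
  rw [e1, ← d, ← d, ← det_updateRow_add]
  have e2 : (Sum.elim a fun _ => 1) + (Sum.elim (-a) fun _ => 1) =
      (2:R) • (Sum.elim (0 : n → R) (fun _ : Unit => (1:R))) := by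
    ext (i | i)
    · simp
    · simp; norm_num
  rw [e2, det_updateRow_smul, d]
  congr 2
  ext; simp

lemma field_case' {K : Type*} [Field K] [CharZero K]
    (Y : Matrix (Fin (2*k)) (Fin (2*k)) K)
    (hsk : ∀ i j, Y j i = - Y i j) (a : Fin (2*k) → K) :
    (Y + Matrix.of fun i j => a i * a j).det = Y.det := by
  have h := det_rank_one Y a
  have : (Y - Matrix.of fun i j => a i * a j).det = (Y + Matrix.of fun i j => a i * a j).det := by
    have e : (Y - Matrix.of fun i j => a i * a j) = - (Y + Matrix.of fun i j => a i * a j)ᵀ := by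
      ext i j
      simp [hsk i j]
      ring
    rw [e, det_neg, det_transpose]
    simp
  rw [this, ← two_mul] at h
  exact mul_left_cancel₀ two_ne_zero h

lemma pfaffian_map {S : Type*} [CommRing S] (f : R →+* S) (Y : Matrix (Fin (2*k)) (Fin (2*k)) R) :
    pfaffian (Y.map f) = f (pfaffian Y) := by
  simp [pfaffian, map_sum, map_prod]

lemma rank_map {S : Type*} [CommRing S] {n : Type*} [Fintype n] [DecidableEq n]
    (f : R →+* S) (Y : Matrix n n R) (a : n → R) :
    (Y.map f + Matrix.of fun i j => f (a i) * f (a j)).det =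
      f (Y + Matrix.of fun i j => a i * a j).det := by
  rw [RingHom.map_det]
  congr 1
  ext i j
  simp

lemma domain_case [IsDomain R] [CharZero R] (Y : Matrix (Fin (2*k)) (Fin (2*k)) R)
    (hsk : ∀ i j, Y j i = - Y i j) (hd : ∀ i, Y i i = 0) (a : Fin (2*k) → R) :
    (Y + Matrix.of fun i j => a i * a j).det = Y.det ∧ pfaffian Y ^ 2 = Y.det := by
  let f := algebraMap R (FractionRing R)
  have hf : Function.Injective f := IsFractionRing.injective R (FractionRing R)
  have : CharZero (FractionRing R) := charZero_of_injective_algebraMap hf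
  have s' : ∀ i j, (Y.map f) j i = - (Y.map f) i j := fun i j => by simp [hsk i j]
  constructor
  · apply hf
    rw [← rank_map, field_case' _ s', RingHom.map_det]; rfl
  · apply hf
    rw [map_pow, ← pfaffian_map, field_case _ s' (fun i => by simp [hd]), RingHom.map_det]; rfl

lemma general (Y : Matrix (Fin (2*k)) (Fin (2*k)) R)
    (hsk : ∀ i j, Y j i = - Y i j) (hd : ∀ i, Y i i = 0) (a : Fin (2*k) → R) :
    (Y + Matrix.of fun i j => a i * a j).det = Y.det ∧ pfaffian Y ^ 2 = Y.det := by
  let G : Matrix (Fin (2*k)) (Fin (2*k)) (MvPolynomial ((Fin (2*k) × Fin (2*k)) ⊕ Fin (2*k)) ℤ) := Matrix.of fun i j =>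
    if i < j then MvPolynomial.X (Sum.inl (i, j)) else
      if j < i then - MvPolynomial.X (Sum.inl (j, i)) else 0
  let b : Fin (2*k) → MvPolynomial ((Fin (2*k) × Fin (2*k)) ⊕ Fin (2*k)) ℤ := fun i => MvPolynomial.X (Sum.inr i)
  let f : MvPolynomial ((Fin (2*k) × Fin (2*k)) ⊕ Fin (2*k)) ℤ →+* R := MvPolynomial.eval₂Hom (Int.castRingHom R) (Sum.elim (fun x => Y x.1 x.2) a)
  have hG : G.map f = Y := by
    ext i j
    rcases lt_trichotomy i j with h | h | h
    · simp [G, f, h]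
    · subst h; simp [G, hd]
    · simp [G, f, h, h.not_gt, hsk j i]
  have hb : ∀ i, f (b i) = a i := fun i => by simp [f, b]
  obtain ⟨h1, h2⟩ := domain_case G (by
    intro i j
    rcases lt_trichotomy i j with h | h | h
    · simp [G, h, h.not_gt]
    · subst h; simp [G]
    · simp [G, h, h.not_gt]) (by intro i; simp [G]) b
  have hdet : Y.det = f G.det := by rw [← hG, RingHom.map_det]; rfl
  constructor
  · rw [hdet, ← h1, ← rank_map, hG]
    simp only [hb]
  · rw [hdet, ← h2, map_pow, ← pfaffian_map, hG]

end PfAux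

/-- Corollary: for a skew-symmetric matrix `Y` of even size `m = 2k` and a symmetric
rank-1 matrix `M = (a_i a_j)`, `det(Y+M) = Pf(Y)² = det(Y)`. -/
theorem det_skew_add_symm_rank_one_even {R : Type*} [CommRing R] (k : ℕ) (hk : 0 < k)
    (Y : Matrix (Fin (2*k)) (Fin (2*k)) R)
    (hY : Yᵀ = -Y) (hdiag : ∀ i, Y i i = 0) (a : Fin (2*k) → R) :
    (Y + Matrix.of fun i j => a i * a j).det = pfaffian Y ^ 2 ∧
      pfaffian Y ^ 2 = Y.det := by
  have hsk : ∀ i j, Y j i = - Y i j := fun i j => congrFun (congrFun hY i) j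
  obtain ⟨h1, h2⟩ := PfAux.general Y hsk hdiag a
  exact ⟨h1.trans h2.symm, h2⟩
end

section
/- Let Y be a skew-symmetric m×m matrix over a commutative ring with m odd, and let M = (a_i·a_j)_{1≤i,j≤m} be a symmetric rank-1 matrix given by elements a_1,…,a_m. Then det(Y + M) = ( Σ_{i=1}^m (−1)^{i−1} a_i · Pf(Y(i)) )², where Y(i) arises from Y by deleting the i-th row and column. -/
open Matrix

def permExt {n : ℕ} (j : Fin (n+1)) (ρ : Equiv.Perm (Fin n)) : Equiv.Perm (Fin (n+1+1)) :=
  Equiv.Perm.decomposeFin.symm (0, (j.cycleRange)⁻¹ * Equiv.Perm.decomposeFin.symm (0, ρ))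

theorem permExt_zero {n : ℕ} (j : Fin (n+1)) (ρ : Equiv.Perm (Fin n)) :
    permExt j ρ 0 = 0 := by
  simp [permExt]

theorem permExt_one {n : ℕ} (j : Fin (n+1)) (ρ : Equiv.Perm (Fin n)) :
    permExt j ρ (Fin.succ 0) = j.succ := by
  simp only [permExt, Equiv.Perm.decomposeFin_symm_apply_succ]
  simp

theorem permExt_succ {n : ℕ} (j : Fin (n+1)) (ρ : Equiv.Perm (Fin n)) (x : Fin n) :
    permExt j ρ x.succ.succ = (j.succAbove (ρ x)).succ := by
  simp only [permExt, Equiv.Perm.decomposeFin_symm_apply_succ]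
  simp

theorem permExt_sign {n : ℕ} (j : Fin (n+1)) (ρ : Equiv.Perm (Fin n)) :
    Equiv.Perm.sign (permExt j ρ) = (-1)^(j:ℕ) * Equiv.Perm.sign ρ := by
  simp [permExt, Fin.sign_cycleRange]

theorem sum_perm_ext {R : Type*} [CommRing R] {n : ℕ} (f : Equiv.Perm (Fin (n+1+1)) → R)
    (hf : ∀ σ, σ 0 ≠ 0 → f σ = 0) :
    ∑ σ, f σ = ∑ j : Fin (n+1), ∑ ρ : Equiv.Perm (Fin n), f (permExt j ρ) := by
  rw [← Equiv.sum_comp (Equiv.Perm.decomposeFin (n := n+1)).symm f, Fintype.sum_prod_type,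
    Finset.sum_eq_single 0]
  · rw [← Fintype.sum_prod_type']
    symm
    have hinj : Function.Injective (fun x : Fin (n+1) × Equiv.Perm (Fin n) =>
        (x.1.cycleRange)⁻¹ * Equiv.Perm.decomposeFin.symm (0, x.2)) := by
      rintro ⟨j, ρ⟩ ⟨j', ρ'⟩ h
      simp only at h
      have h0 := congrArg (fun e : Equiv.Perm (Fin (n+1)) => e 0) h
      simp at h0
      subst h0
      have := mul_left_cancel h
      have := Equiv.injective _ this
      simpa using this
    have hbij : Function.Bijective (fun x : Fin (n+1) × Equiv.Perm (Fin n) =>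
        (x.1.cycleRange)⁻¹ * Equiv.Perm.decomposeFin.symm (0, x.2)) := by
      rw [Fintype.bijective_iff_injective_and_card]
      refine ⟨hinj, ?_⟩
      simp [Fintype.card_perm, Nat.factorial_succ]
    exact Fintype.sum_bijective _ hbij _ _ (fun x => rfl)
  · intro p _ hp
    apply Finset.sum_eq_zero
    intro τ _
    apply hf
    simpa using hp
  · simp

abbrev ev {k : ℕ} (i : Fin k) : Fin (2*k) := ⟨2*(i:ℕ), by have := i.isLt; omega⟩
abbrev od {k : ℕ} (i : Fin k) : Fin (2*k) := ⟨2*(i:ℕ)+1, by have := i.isLt; omega⟩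

def IsNormal {k : ℕ} (σ : Equiv.Perm (Fin (2*k))) : Prop :=
  (∀ i : Fin k, σ (ev i) < σ (od i)) ∧ (∀ i j : Fin k, i < j → σ (ev i) < σ (ev j))

def pterm {R : Type*} [CommRing R] {k : ℕ} (Y : Matrix (Fin (2*k)) (Fin (2*k)) R)
    (σ : Equiv.Perm (Fin (2*k))) : R :=
  ((Equiv.Perm.sign σ : ℤ) : R) * ∏ i : Fin k, Y (σ (ev i)) (σ (od i))

open Classical in
theorem pfaffian_eq {R : Type*} [CommRing R] {k : ℕ} (Y : Matrix (Fin (2*k)) (Fin (2*k)) R) :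
    pfaffian Y = ∑ σ, if IsNormal σ then pterm Y σ else 0 := by
  rw [← Finset.sum_filter]
  unfold pfaffian pterm IsNormal
  congr 1
  ext σ
  simp

def fullPf {R : Type*} [CommRing R] {k : ℕ} (Y : Matrix (Fin (2*k)) (Fin (2*k)) R) : R :=
  ∑ σ, pterm Y σ

set_option linter.unusedSimpArgs false

theorem ev_ne_od {k : ℕ} (i j : Fin k) : ev i ≠ od j := by
  intro h
  have := congrArg Fin.val h
  simp only [ev, od] at this
  omega

theorem ev_inj {k : ℕ} : Function.Injective (ev : Fin k → Fin (2*k)) := by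
  intro i j h
  have := congrArg Fin.val h
  simp only [ev] at this
  exact Fin.ext (by omega)

theorem od_inj {k : ℕ} : Function.Injective (od : Fin k → Fin (2*k)) := by
  intro i j h
  have := congrArg Fin.val h
  simp only [od] at this
  exact Fin.ext (by omega)

theorem ev_od_cases {k : ℕ} (q : Fin (2*k)) : ∃ i : Fin k, q = ev i ∨ q = od i := by
  refine ⟨⟨q/2, by omega⟩, ?_⟩
  simp only [ev, od, Fin.ext_iff]
  omega

theorem IsNormal.zero {k : ℕ} {σ : Equiv.Perm (Fin (2*(k+1)))} (h : IsNormal σ) :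
    σ (0 : Fin (2*k+1+1)) = (0 : Fin (2*k+1+1)) := by
  obtain ⟨q, hq⟩ := σ.surjective (0 : Fin (2*k+1+1))
  obtain ⟨i, rfl | rfl⟩ := ev_od_cases q
  · by_cases hi : i = 0
    · subst hi
      exact hq
    · have := h.2 0 i (Fin.pos_iff_ne_zero.2 hi)
      rw [hq] at this
      exact absurd this (Nat.not_lt_zero _)
  · have := h.1 i
    rw [hq] at this
    exact absurd this (Nat.not_lt_zero _)

theorem permExt_normal {k : ℕ} (j : Fin (2*k+1)) (ρ : Equiv.Perm (Fin (2*k))) :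
    IsNormal (k := k+1) (permExt j ρ) ↔ IsNormal ρ := by
  have h0 : (permExt j ρ : Equiv.Perm (Fin (2*(k+1)))) (ev (0 : Fin (k+1))) = (0 : Fin (2*k+1+1)) :=
    permExt_zero j ρ
  have h1 : (permExt j ρ : Equiv.Perm (Fin (2*(k+1)))) (od (0 : Fin (k+1))) = j.succ := permExt_one j ρ
  have he : ∀ i : Fin k, (permExt j ρ : Equiv.Perm (Fin (2*(k+1)))) (ev i.succ)
      = (j.succAbove (ρ (ev i))).succ := fun i => permExt_succ j ρ (ev i)
  have ho : ∀ i : Fin k, (permExt j ρ : Equiv.Perm (Fin (2*(k+1)))) (od i.succ)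
      = (j.succAbove (ρ (od i))).succ := fun i => permExt_succ j ρ (od i)
  have key : ∀ x y : Fin (2*k), (show Fin (2*(k+1)) from (j.succAbove x).succ) <
      (show Fin (2*(k+1)) from (j.succAbove y).succ) ↔ x < y := by
    intro x y
    exact Fin.succ_lt_succ_iff.trans (Fin.succAbove_lt_succAbove_iff)
  unfold IsNormal
  constructor
  · rintro ⟨ha, hb⟩
    refine ⟨fun i => ?_, fun i i' hi => ?_⟩
    · have := ha i.succ
      rw [he, ho] at this
      exact (key _ _).1 this
    · have := hb i.succ i'.succ (Fin.succ_lt_succ_iff.2 hi)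
      rw [he, he] at this
      exact (key _ _).1 this
  · rintro ⟨ha, hb⟩
    refine ⟨fun i => ?_, fun i i' hi => ?_⟩
    · refine Fin.cases ?_ (fun i => ?_) i
      · rw [h0, h1]; exact Fin.succ_pos j
      · rw [he, ho]; exact (key _ _).2 (ha i)
    · induction i' using Fin.cases with
      | zero => exact absurd hi (Fin.not_lt_zero _)
      | succ i' =>
        induction i using Fin.cases with
        | zero => rw [h0, he]; exact Fin.succ_pos _
        | succ i => rw [he, he]; exact (key _ _).2 (hb i i' (Fin.succ_lt_succ_iff.1 hi))

def subJ {R : Type*} {k : ℕ} (Z : Matrix (Fin (2*(k+1))) (Fin (2*(k+1))) R) (j : Fin (2*k+1)) :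
    Matrix (Fin (2*k)) (Fin (2*k)) R :=
  fun x y => Z ((j.succAbove x).succ : Fin (2*k+1+1)) ((j.succAbove y).succ : Fin (2*k+1+1))

theorem pterm_ext {R : Type*} [CommRing R] {k : ℕ} (Z : Matrix (Fin (2*(k+1))) (Fin (2*(k+1))) R)
    (j : Fin (2*k+1)) (ρ : Equiv.Perm (Fin (2*k))) :
    pterm Z (permExt j ρ) =
      (-1)^(j:ℕ) * Z (0 : Fin (2*k+1+1)) (j.succ : Fin (2*k+1+1)) * pterm (subJ Z j) ρ := by
  have h0 : (permExt j ρ : Equiv.Perm (Fin (2*(k+1)))) (ev (0 : Fin (k+1))) = (0 : Fin (2*k+1+1)) :=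
    permExt_zero j ρ
  have h1 : (permExt j ρ : Equiv.Perm (Fin (2*(k+1)))) (od (0 : Fin (k+1))) = j.succ := permExt_one j ρ
  have he : ∀ i : Fin k, (permExt j ρ : Equiv.Perm (Fin (2*(k+1)))) (ev i.succ)
      = (j.succAbove (ρ (ev i))).succ := fun i => permExt_succ j ρ (ev i)
  have ho : ∀ i : Fin k, (permExt j ρ : Equiv.Perm (Fin (2*(k+1)))) (od i.succ)
      = (j.succAbove (ρ (od i))).succ := fun i => permExt_succ j ρ (od i)
  have hs : Equiv.Perm.sign (permExt j ρ : Equiv.Perm (Fin (2*(k+1)))) =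
    (-1)^(j:ℕ) * Equiv.Perm.sign ρ := permExt_sign j ρ
  unfold pterm subJ
  rw [Fin.prod_univ_succ, hs, h0, h1]
  simp only [he, ho]
  push_cast
  ring

theorem pfaffian_expand {R : Type*} [CommRing R] {k : ℕ}
    (Z : Matrix (Fin (2*(k+1))) (Fin (2*(k+1))) R) :
    pfaffian Z = ∑ j : Fin (2*k+1),
      (-1)^(j:ℕ) * Z (0 : Fin (2*k+1+1)) (j.succ : Fin (2*k+1+1)) * pfaffian (subJ Z j) := by
  classical
  rw [pfaffian_eq]
  refine (sum_perm_ext (n := 2*k) _ ?_).trans ?_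
  · intro σ hσ
    rw [if_neg]
    intro h
    exact hσ h.zero
  · refine Finset.sum_congr rfl fun j _ => ?_
    rw [pfaffian_eq, Finset.mul_sum]
    refine Finset.sum_congr rfl fun ρ _ => ?_
    by_cases h : IsNormal ρ
    · rw [if_pos h, if_pos ((permExt_normal j ρ).2 h), pterm_ext]
    · rw [if_neg h, if_neg (fun h' => h ((permExt_normal j ρ).1 h')), mul_zero]

theorem pfaffian_zero {R : Type*} [CommRing R] (Z : Matrix (Fin (2*0)) (Fin (2*0)) R) :
    pfaffian Z = 1 := by
  classical
  rw [pfaffian_eq]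
  have : Subsingleton (Equiv.Perm (Fin (2*0))) := by
    show Subsingleton (Equiv.Perm (Fin 0)); infer_instance
  rw [Fintype.sum_subsingleton _ 1]
  rw [if_pos ⟨fun i => i.elim0, fun i => i.elim0⟩]
  simp [pterm]

/-- skew -/
def Skew {R : Type*} [CommRing R] {n : ℕ} (Y : Matrix (Fin n) (Fin n) R) : Prop :=
  ∀ i j, Y i j = - Y j i

theorem pterm_swap_pair {R : Type*} [CommRing R] {k : ℕ} (Y : Matrix (Fin (2*k)) (Fin (2*k)) R)
    (hY : Skew Y) (σ : Equiv.Perm (Fin (2*k))) (i : Fin k) :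
    pterm Y (σ * Equiv.swap (ev i) (od i)) = pterm Y σ := by
  unfold pterm
  have hne : (ev i : Fin (2*k)) ≠ od i := by simp [ev, od]
  rw [Equiv.Perm.sign_mul, Equiv.Perm.sign_swap hne,
    ← Finset.mul_prod_erase _ _ (Finset.mem_univ i),
    ← Finset.mul_prod_erase Finset.univ (fun i => Y (σ (ev i)) (σ (od i))) (Finset.mem_univ i)]
  have : ∏ x ∈ Finset.univ.erase i, Y ((σ * Equiv.swap (ev i) (od i)) (ev x))
      ((σ * Equiv.swap (ev i) (od i)) (od x)) =
      ∏ x ∈ Finset.univ.erase i, Y (σ (ev x)) (σ (od x)) := by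
    refine Finset.prod_congr rfl fun x hx => ?_
    have hx : x ≠ i := Finset.ne_of_mem_erase hx
    have hx' : (x:ℕ) ≠ i := fun h => hx (Fin.ext h)
    rw [Equiv.Perm.mul_apply, Equiv.Perm.mul_apply,
      Equiv.swap_apply_of_ne_of_ne, Equiv.swap_apply_of_ne_of_ne] <;>
    · simp only [ev, od, ne_eq, Fin.ext_iff]; omega
  rw [this]
  simp only [Equiv.Perm.mul_apply, Equiv.swap_apply_left, Equiv.swap_apply_right]
  rw [hY (σ (od i))]
  push_cast
  ring

theorem pterm_swap_pairs {R : Type*} [CommRing R] {k : ℕ} (Y : Matrix (Fin (2*k)) (Fin (2*k)) R)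
    (σ : Equiv.Perm (Fin (2*k))) (i j : Fin k) :
    pterm Y (σ * (Equiv.swap (ev i) (ev j) * Equiv.swap (od i) (od j))) = pterm Y σ := by
  unfold pterm
  have hs : Equiv.Perm.sign (Equiv.swap (ev i) (ev j) * Equiv.swap (od i) (od j)) = 1 := by
    rw [Equiv.Perm.sign_mul, Equiv.Perm.sign_swap', Equiv.Perm.sign_swap']
    by_cases h : i = j
    · simp [h]
    · have : (i:ℕ) ≠ j := fun h' => h (Fin.ext h')
      simp [ev, od, this]
  rw [Equiv.Perm.sign_mul, hs, mul_one]
  congr 1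
  rw [← Equiv.prod_comp (Equiv.swap i j) (fun x => Y (σ (ev x)) (σ (od x)))]
  refine Finset.prod_congr rfl fun x _ => ?_
  have e1 : (Equiv.swap (ev i) (ev j) * Equiv.swap (od i) (od j)) (ev x) =
      ev (Equiv.swap i j x) := by
    rw [Equiv.Perm.mul_apply, Equiv.swap_apply_of_ne_of_ne (ev_ne_od _ _) (ev_ne_od _ _),
      ev_inj.swap_apply]
  have e2 : (Equiv.swap (ev i) (ev j) * Equiv.swap (od i) (od j)) (od x) =
      od (Equiv.swap i j x) := by
    rw [Equiv.Perm.mul_apply, od_inj.swap_apply,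
      Equiv.swap_apply_of_ne_of_ne (ev_ne_od _ _).symm (ev_ne_od _ _).symm]
  rw [Equiv.Perm.mul_apply σ, Equiv.Perm.mul_apply σ, e1, e2]

theorem fullPf_expand {R : Type*} [CommRing R] {k : ℕ}
    (Z : Matrix (Fin (2*(k+1))) (Fin (2*(k+1))) R) (hZ : Skew Z) :
    fullPf Z = (2*(k+1) : ℕ) * ∑ j : Fin (2*k+1),
      (-1)^(j:ℕ) * Z (0 : Fin (2*k+1+1)) (j.succ : Fin (2*k+1+1)) * fullPf (subJ Z j) := by
  classical
  let z : Fin (2*(k+1)) := (0 : Fin (2*k+1+1))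
  have hz : z = ev 0 := rfl
  have A : ∑ σ, (if σ z = z then pterm Z σ else 0) = ∑ j : Fin (2*k+1),
      (-1)^(j:ℕ) * Z (0 : Fin (2*k+1+1)) (j.succ : Fin (2*k+1+1)) * fullPf (subJ Z j) := by
    refine (sum_perm_ext (n := 2*k) _ ?_).trans ?_
    · intro σ hσ
      rw [if_neg hσ]
    · refine Finset.sum_congr rfl fun j _ => ?_
      rw [fullPf, Finset.mul_sum]
      refine Finset.sum_congr rfl fun ρ _ => ?_
      rw [if_pos (permExt_zero j ρ), pterm_ext]
  have B : ∀ q, ∑ σ, (if σ q = z then pterm Z σ else 0) =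
      ∑ σ, (if σ z = z then pterm Z σ else 0) := by
    have Be : ∀ i, ∑ σ, (if σ (ev i) = z then pterm Z σ else 0) =
      ∑ σ, (if σ z = z then pterm Z σ else 0) := by
      intro i
      rw [← Equiv.sum_comp (Equiv.mulRight (Equiv.swap (ev 0) (ev i) * Equiv.swap (od 0) (od i)))
        (fun σ => if σ (ev i) = z then pterm Z σ else 0)]
      refine Finset.sum_congr rfl fun σ _ => ?_
      simp only [Equiv.coe_mulRight]
      rw [pterm_swap_pairs]
      have : (σ * (Equiv.swap (ev 0) (ev i) * Equiv.swap (od 0) (od i))) (ev i) = σ z := by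
        rw [Equiv.Perm.mul_apply, Equiv.Perm.mul_apply,
          Equiv.swap_apply_of_ne_of_ne (ev_ne_od _ _) (ev_ne_od _ _), Equiv.swap_apply_right]
        rfl
      simp only [this]
    intro q
    obtain ⟨i, rfl | rfl⟩ := ev_od_cases q
    · exact Be i
    · rw [← Be i, ← Equiv.sum_comp (Equiv.mulRight (Equiv.swap (ev i) (od i)))
        (fun σ => if σ (od i) = z then pterm Z σ else 0)]
      refine Finset.sum_congr rfl fun σ _ => ?_
      simp only [Equiv.coe_mulRight]
      rw [pterm_swap_pair _ hZ]
      simp only [Equiv.Perm.mul_apply, Equiv.swap_apply_right]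
  rw [← A]
  have C : fullPf Z = ∑ σ, ∑ q, if σ q = z then pterm Z σ else 0 := by
    rw [fullPf]
    refine Finset.sum_congr rfl fun σ _ => ?_
    rw [Finset.sum_eq_single (σ.symm z)]
    · simp
    · intro q _ hq
      rw [if_neg]
      intro h
      exact hq (by rw [← h]; simp)
    · simp
  rw [C, Finset.sum_comm, Finset.sum_congr rfl (fun q _ => B q)]
  simp

theorem fullPf_eq {R : Type*} [CommRing R] {k : ℕ}
    (Z : Matrix (Fin (2*k)) (Fin (2*k)) R) (hZ : Skew Z) :
    fullPf Z = (2^k * k.factorial : ℕ) * pfaffian Z := by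
  induction k with
  | zero =>
    rw [pfaffian_zero]
    have : Subsingleton (Equiv.Perm (Fin (2*0))) := by
      show Subsingleton (Equiv.Perm (Fin 0)); infer_instance
    rw [fullPf, Fintype.sum_subsingleton _ 1]
    simp [pterm]
  | succ k ih =>
    rw [fullPf_expand Z hZ, pfaffian_expand, Finset.mul_sum, Finset.mul_sum]
    refine Finset.sum_congr rfl fun j _ => ?_
    rw [ih (subJ Z j) (fun x y => hZ _ _)]
    push_cast [Nat.factorial_succ]
    ring

theorem fullPf_swap {R : Type*} [CommRing R] {k : ℕ}
    (Z : Matrix (Fin (2*k)) (Fin (2*k)) R) (x y : Fin (2*k)) (hxy : x ≠ y)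
    (h : ∀ i j, Z (Equiv.swap x y i) (Equiv.swap x y j) = Z i j) :
    fullPf Z = - fullPf Z := by
  conv_lhs => rw [fullPf, ← Equiv.sum_comp (Equiv.mulLeft (Equiv.swap x y))]
  rw [fullPf, ← Finset.sum_neg_distrib]
  refine Finset.sum_congr rfl fun σ _ => ?_
  simp only [Equiv.coe_mulLeft, pterm, Equiv.Perm.mul_apply, h, Equiv.Perm.sign_mul,
    Equiv.Perm.sign_swap hxy]
  push_cast
  ring

theorem pfaffian_swap_zero {R : Type*} [CommRing R] [IsDomain R] [CharZero R] {k : ℕ}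
    (Z : Matrix (Fin (2*k)) (Fin (2*k)) R) (hZ : Skew Z) (x y : Fin (2*k)) (hxy : x ≠ y)
    (h : ∀ i j, Z (Equiv.swap x y i) (Equiv.swap x y j) = Z i j) :
    pfaffian Z = 0 := by
  have h1 := self_eq_neg.1 (fullPf_swap Z x y hxy h)
  rw [fullPf_eq Z hZ] at h1
  rcases mul_eq_zero.1 h1 with h2 | h2
  · exfalso
    have : 2^k * k.factorial ≠ 0 := by positivity
    exact this (by exact_mod_cast h2)
  · exact h2

def border {R : Type*} [CommRing R] {n : ℕ} (c : R) (a : Fin n → R)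
    (Y : Matrix (Fin n) (Fin n) R) : Matrix (Fin (n+1)) (Fin (n+1)) R :=
  fun x y => (Fin.cons (Fin.cons c a : Fin (n+1) → R)
    (fun i => (Fin.cons (-a i) (Y i) : Fin (n+1) → R)) : Fin (n+1) → Fin (n+1) → R) x y

theorem border_zero_zero {R : Type*} [CommRing R] {n : ℕ} (c : R) (a : Fin n → R)
    (Y : Matrix (Fin n) (Fin n) R) : border c a Y 0 0 = c := rfl
theorem border_zero_succ {R : Type*} [CommRing R] {n : ℕ} (c : R) (a : Fin n → R)
    (Y : Matrix (Fin n) (Fin n) R) (j : Fin n) : border c a Y 0 j.succ = a j := rfl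
theorem border_succ_zero {R : Type*} [CommRing R] {n : ℕ} (c : R) (a : Fin n → R)
    (Y : Matrix (Fin n) (Fin n) R) (i : Fin n) : border c a Y i.succ 0 = - a i := rfl
theorem border_succ_succ {R : Type*} [CommRing R] {n : ℕ} (c : R) (a : Fin n → R)
    (Y : Matrix (Fin n) (Fin n) R) (i j : Fin n) : border c a Y i.succ j.succ = Y i j := rfl

theorem border_skew {R : Type*} [CommRing R] {n : ℕ} (a : Fin n → R)
    (Y : Matrix (Fin n) (Fin n) R) (hY : Skew Y) : Skew (border 0 a Y) := by
  intro x y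
  refine Fin.cases ?_ (fun i => ?_) x <;> refine Fin.cases ?_ (fun j => ?_) y
  · simp [border_zero_zero]
  · simp [border_zero_succ, border_succ_zero]
  · simp [border_zero_succ, border_succ_zero]
  · simpa [border_succ_succ] using hY i j

theorem pfaffian_border {R : Type*} [CommRing R] {k : ℕ} (a : Fin (2*k+1) → R)
    (Y : Matrix (Fin (2*k+1)) (Fin (2*k+1)) R) :
    pfaffian (k := k+1) (border 0 a Y) =
      ∑ j : Fin (2*k+1), (-1)^(j:ℕ) * a j * pfaffian (Y.submatrix j.succAbove j.succAbove) := by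
  rw [pfaffian_expand]
  rfl

theorem det_border {R : Type*} [CommRing R] {n : ℕ} (c : R) (a : Fin (n+1) → R)
    (Y : Matrix (Fin (n+1)) (Fin (n+1)) R) :
    (border c a Y).det = c * Y.det + ∑ j, ∑ i, a j * a i * Y.adjugate j i := by
  rw [Matrix.det_succ_row_zero, Fin.sum_univ_succ]
  congr 1
  · have : (border c a Y).submatrix Fin.succ (Fin.succAbove 0) = Y := by
      ext i j
      simp [border_succ_succ]
    rw [this]
    simp [border_zero_zero]
  · refine Finset.sum_congr rfl fun j _ => ?_
    rw [Matrix.det_succ_column_zero, Finset.mul_sum]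
    refine Finset.sum_congr rfl fun i _ => ?_
    have h : ((border c a Y).submatrix Fin.succ (Fin.succAbove j.succ)).submatrix i.succAbove Fin.succ
        = Y.submatrix i.succAbove j.succAbove := by
      ext x y
      simp [border_succ_succ]
    rw [h, Matrix.adjugate_fin_succ_eq_det_submatrix, border_zero_succ, Matrix.submatrix_apply]
    rw [Fin.succ_succAbove_zero, border_succ_zero, Fin.val_succ]
    ring

theorem det_border_one {R : Type*} [CommRing R] {n : ℕ} (a : Fin (n+1) → R)
    (Y : Matrix (Fin (n+1)) (Fin (n+1)) R) :
    (border 1 a Y).det = (Y + Matrix.of fun i j => a i * a j).det := by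
  set W := Y + Matrix.of fun i j => a i * a j with hW
  let B : Matrix (Fin (n+1+1)) (Fin (n+1+1)) R := fun x y =>
    (Fin.cons (Fin.cons 1 a : Fin (n+1+1) → R)
    (fun i => (Fin.cons 0 (W i) : Fin (n+1+1) → R)) : Fin (n+1+1) → Fin (n+1+1) → R) x y
  have h1 : (border 1 a Y).det = B.det := by
    refine Matrix.det_eq_of_forall_row_eq_smul_add_const (Fin.cons 0 (fun i => - a i)) 0 rfl ?_
    intro x y
    refine Fin.cases ?_ (fun i => ?_) x <;> refine Fin.cases ?_ (fun j => ?_) y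
    · simp [border_zero_zero, B]
    · simp [border_zero_succ, B]
    · simp [border_succ_zero, B]
    · simp [border_succ_succ, B, hW]
  rw [h1, Matrix.det_succ_column_zero, Fin.sum_univ_succ]
  have h2 : B.submatrix (Fin.succAbove 0) Fin.succ = W := by
    ext i j
    rw [Fin.succAbove_zero]
    rfl
  rw [h2]
  simp [B]

theorem pf_kernel {R : Type*} [CommRing R] [IsDomain R] [CharZero R] {k : ℕ}
    (Y : Matrix (Fin (2*k+1)) (Fin (2*k+1)) R) (hY : Skew Y) (l : Fin (2*k+1)) :
    ∑ j : Fin (2*k+1), Y l j * ((-1)^(j:ℕ) * pfaffian (Y.submatrix j.succAbove j.succAbove)) = 0 := by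
  have h := pfaffian_border (Y l) Y
  have hll : Y l l = 0 := self_eq_neg.1 (hY l l)
  have hsk := border_skew (Y l) Y hY
  have hrow : ∀ y, border 0 (Y l) Y 0 y = border 0 (Y l) Y l.succ y := by
    intro y
    refine Fin.cases ?_ (fun j => ?_) y
    · simp [border_zero_zero, border_succ_zero, hll]
    · simp [border_zero_succ, border_succ_succ]
  have hrow' : ∀ x y, border 0 (Y l) Y (Equiv.swap 0 l.succ x) y = border 0 (Y l) Y x y := by
    intro x y
    rw [Equiv.swap_apply_def]
    split_ifs with h1 h2
    · rw [h1, hrow]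
    · rw [h2, hrow]
    · rfl
  rw [pfaffian_swap_zero (k := k+1) (border 0 (Y l) Y) hsk (0 : Fin (2*k+1+1)) l.succ
    (Fin.succ_ne_zero l).symm] at h
  · rw [h]
    refine Finset.sum_congr rfl fun j _ => ?_
    ring
  · intro x y
    refine (hrow' _ _).trans ?_
    rw [hsk]
    refine (congrArg Neg.neg (hrow' _ _)).trans ?_
    exact (hsk _ _).symm

theorem det_odd {R : Type*} [CommRing R] [IsDomain R] [CharZero R] {k : ℕ}
    (Y : Matrix (Fin (2*k+1)) (Fin (2*k+1)) R) (hY : Skew Y) : Y.det = 0 := by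
  have h : Yᵀ = -Y := by
    ext i j
    exact hY j i
  have h2 := Matrix.det_neg Y
  rw [← h, Matrix.det_transpose, Fintype.card_fin] at h2
  rw [Odd.neg_one_pow ⟨k, rfl⟩, neg_one_mul] at h2
  exact self_eq_neg.1 h2

theorem adj_domain {R : Type*} [CommRing R] [IsDomain R] [CharZero R] {k : ℕ}
    (Y : Matrix (Fin (2*k+1)) (Fin (2*k+1)) R) (hY : Skew Y)
    (hne : ∀ i : Fin (2*k+1), pfaffian (Y.submatrix i.succAbove i.succAbove) ≠ 0)
    (hd : ∀ i : Fin (2*k+1), (Y.submatrix i.succAbove i.succAbove).det =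
      pfaffian (Y.submatrix i.succAbove i.succAbove) ^ 2) (l i : Fin (2*k+1)) :
    Y.adjugate l i =
      ((-1)^(l:ℕ) * pfaffian (Y.submatrix l.succAbove l.succAbove)) *
      ((-1)^(i:ℕ) * pfaffian (Y.submatrix i.succAbove i.succAbove)) := by
  have hdet := det_odd Y hY
  have hker := pf_kernel Y hY
  have hadj : ∀ r, ∑ j, Y r j * Y.adjugate j i = 0 := by
    intro r
    have := congrFun (congrFun (Matrix.mul_adjugate Y) r) i
    rw [hdet, zero_smul, Matrix.mul_apply] at this
    exact this
  have hii : Y.adjugate i i = pfaffian (Y.submatrix i.succAbove i.succAbove) ^ 2 := by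
    rw [Matrix.adjugate_fin_succ_eq_det_submatrix, hd, Even.neg_one_pow ⟨i, rfl⟩, one_mul]
  have hpne : (-1)^(i:ℕ) * pfaffian (Y.submatrix i.succAbove i.succAbove) ≠ 0 :=
    mul_ne_zero (pow_ne_zero _ (by simp)) (hne i)
  have hpsq : Y.adjugate i i =
      ((-1)^(i:ℕ) * pfaffian (Y.submatrix i.succAbove i.succAbove)) ^ 2 := by
    rw [hii, mul_pow, ← pow_mul, mul_comm (i:ℕ) 2, pow_mul]
    simp
  have hdi : (Y.submatrix i.succAbove i.succAbove).det ≠ 0 := by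
    rw [hd]; exact pow_ne_zero _ (hne i)
  generalize hp : (fun j : Fin (2*k+1) =>
    (-1)^(j:ℕ) * pfaffian (Y.submatrix j.succAbove j.succAbove)) = p at *
  have hp' : ∀ j : Fin (2*k+1),
    (-1)^(j:ℕ) * pfaffian (Y.submatrix j.succAbove j.succAbove) = p j := fun j => congrFun hp j
  simp only [hp'] at *
  let w : Fin (2*k+1) → R := fun j => p i * Y.adjugate j i - Y.adjugate i i * p j
  have hw : ∀ r, ∑ j, Y r j * w j = 0 := by
    intro r
    have : ∑ j, Y r j * w j = p i * ∑ j, Y r j * Y.adjugate j i -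
        Y.adjugate i i * ∑ j, Y r j * p j := by
      rw [Finset.mul_sum, Finset.mul_sum, ← Finset.sum_sub_distrib]
      refine Finset.sum_congr rfl fun j _ => ?_
      simp only [w]; ring
    rw [this, hadj, hker]; simp
  have hwi : w i = 0 := by simp only [w]; ring
  have hv : (fun x => w (i.succAbove x)) = 0 := by
    apply Matrix.eq_zero_of_mulVec_eq_zero hdi
    ext x
    have := hw (i.succAbove x)
    rw [Fin.sum_univ_succAbove _ i, hwi, mul_zero, zero_add] at this
    exact this
  have hwl : w l = 0 := by
    by_cases hl : l = i
    · rw [hl, hwi]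
    · obtain ⟨x, rfl⟩ := Fin.exists_succAbove_eq hl
      exact congrFun hv x
  have h3 : p i * Y.adjugate l i = p i * (p l * p i) := by
    have := sub_eq_zero.1 hwl
    rw [this, hpsq]; ring
  exact mul_left_cancel₀ hpne h3

theorem pfaffian_map {R S : Type*} [CommRing R] [CommRing S] (φ : R →+* S) {k : ℕ}
    (Y : Matrix (Fin (2*k)) (Fin (2*k)) R) : pfaffian (Y.map φ) = φ (pfaffian Y) := by
  simp [pfaffian, map_sum, map_prod]

def onesM (n : ℕ) : Matrix (Fin n) (Fin n) ℤ :=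
  fun i j => if i < j then 1 else if j < i then -1 else 0

theorem onesM_sub {n m : ℕ} (f : Fin n → Fin m) (hf : StrictMono f) :
    (onesM m).submatrix f f = onesM n := by
  ext i j
  simp [onesM, hf.lt_iff_lt]

theorem pf_ones (k : ℕ) : pfaffian (onesM (2*k)) = 1 := by
  induction k with
  | zero => exact pfaffian_zero _
  | succ k ih =>
    rw [pfaffian_expand]
    have h : ∀ j : Fin (2*k+1), subJ (onesM (2*(k+1))) j = onesM (2*k) := by
      intro j
      exact onesM_sub (m := 2*k+1+1) (fun x => (j.succAbove x).succ)
        (Fin.strictMono_succ.comp (Fin.strictMono_succAbove j))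
    have h2 : ∀ j : Fin (2*k+1),
        onesM (2*(k+1)) (0 : Fin (2*k+1+1)) (j.succ : Fin (2*k+1+1)) = 1 := by
      intro j
      exact if_pos (Fin.succ_pos j)
    simp only [h, h2, ih, mul_one]
    rw [Fin.sum_neg_one_pow, if_neg]
    simp

noncomputable def genM (n : ℕ) : Matrix (Fin n) (Fin n) (MvPolynomial (Fin n × Fin n) ℤ) :=
  fun i j => if i < j then MvPolynomial.X (i,j) else
    if j < i then - MvPolynomial.X (j,i) else 0

theorem genM_skew (n : ℕ) : Skew (genM n) := by
  intro i j
  unfold genM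
  rcases lt_trichotomy i j with h | h | h
  · simp [h, h.not_gt]
  · simp [h]
  · simp [h, h.not_gt]

theorem genM_map {R : Type*} [CommRing R] {n : ℕ} (Y : Matrix (Fin n) (Fin n) R) (hY : Skew Y)
    (hdiag : ∀ i, Y i i = 0) :
    (genM n).map (MvPolynomial.eval₂Hom (Int.castRingHom R) (fun x => Y x.1 x.2)) = Y := by
  ext i j
  rw [Matrix.map_apply]
  unfold genM
  rcases lt_trichotomy i j with h | h | h
  · simp [h]
  · simp [h, hdiag]
  · simp [h, h.not_gt, hY i j]

theorem genM_ne {k : ℕ} (i : Fin (2*k+1)) :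
    pfaffian ((genM (2*k+1)).submatrix i.succAbove i.succAbove) ≠ 0 := by
  intro h
  have h1 := genM_map (onesM (2*k+1)) (by
    intro i j
    unfold onesM
    rcases lt_trichotomy i j with h | h | h
    · simp [h, h.not_gt]
    · simp [h]
    · simp [h, h.not_gt]) (by intro i; simp [onesM])
  have h2 := congrArg (MvPolynomial.eval₂Hom (Int.castRingHom ℤ)
    (fun x => (onesM (2*k+1)) x.1 x.2)) h
  rw [← pfaffian_map, ← Matrix.submatrix_map, h1, onesM_sub _ (Fin.strictMono_succAbove i),
    pf_ones, map_zero] at h2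
  exact one_ne_zero h2

theorem adj_gen {R : Type*} [CommRing R] {k : ℕ}
    (IH : ∀ (S : Type) [CommRing S] (Y : Matrix (Fin (2*k)) (Fin (2*k)) S), Skew Y →
      (∀ i, Y i i = 0) → Y.det = pfaffian Y ^ 2)
    (Y : Matrix (Fin (2*k+1)) (Fin (2*k+1)) R) (hY : Skew Y) (hdiag : ∀ i, Y i i = 0) :
    Y.det = 0 ∧ ∀ l i, Y.adjugate l i =
      ((-1)^(l:ℕ) * pfaffian (Y.submatrix l.succAbove l.succAbove)) *
      ((-1)^(i:ℕ) * pfaffian (Y.submatrix i.succAbove i.succAbove)) := by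
  have hg := genM_map Y hY hdiag
  set φ := MvPolynomial.eval₂Hom (Int.castRingHom R)
    (fun x : Fin (2*k+1) × Fin (2*k+1) => Y x.1 x.2)
  constructor
  · have := congrArg φ (det_odd _ (genM_skew (2*k+1)))
    rw [RingHom.map_det, map_zero] at this
    rw [← hg]
    exact this
  · intro l i
    have := congrArg φ (adj_domain _ (genM_skew (2*k+1)) genM_ne
      (fun i => IH _ _ (fun x y => genM_skew _ _ _) (fun x => by simp [genM])) l i)
    rw [map_mul, map_mul, map_mul, ← pfaffian_map, ← pfaffian_map, ← Matrix.submatrix_map,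
      ← Matrix.submatrix_map, hg] at this
    have h2 := congrFun (congrFun (RingHom.map_adjugate φ (genM (2*k+1))) l) i
    rw [RingHom.mapMatrix_apply, RingHom.mapMatrix_apply, hg, Matrix.map_apply] at h2
    rw [← h2, this]
    simp

theorem sum_adj {R : Type*} [CommRing R] {k : ℕ} (Y : Matrix (Fin (2*k+1)) (Fin (2*k+1)) R)
    (a : Fin (2*k+1) → R) (h : ∀ l i, Y.adjugate l i =
      ((-1)^(l:ℕ) * pfaffian (Y.submatrix l.succAbove l.succAbove)) *
      ((-1)^(i:ℕ) * pfaffian (Y.submatrix i.succAbove i.succAbove))) :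
    ∑ j, ∑ i, a j * a i * Y.adjugate j i = (∑ i : Fin (2*k+1),
          (-1 : R)^(i:ℕ) * a i * pfaffian (Y.submatrix i.succAbove i.succAbove)) ^ 2 := by
  rw [sq, Finset.sum_mul_sum]
  refine Finset.sum_congr rfl fun j _ => Finset.sum_congr rfl fun i _ => ?_
  rw [h]; ring

theorem det_pf (k : ℕ) : ∀ (S : Type) [CommRing S] (Y : Matrix (Fin (2*k)) (Fin (2*k)) S), Skew Y →
      (∀ i, Y i i = 0) → Y.det = pfaffian Y ^ 2 := by
  induction k with
  | zero =>
    intro S _ Y _ _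
    rw [pfaffian_zero, one_pow]
    exact Matrix.det_fin_zero (A := Y)
  | succ k ih =>
    intro S _ Z hZ hdiag
    let Z' : Matrix (Fin (2*k+1+1)) (Fin (2*k+1+1)) S := Z
    let Y : Matrix (Fin (2*k+1)) (Fin (2*k+1)) S := Z'.submatrix Fin.succ Fin.succ
    let a : Fin (2*k+1) → S := fun j => Z' 0 j.succ
    have hb : Z = border 0 a Y := by
      show Z' = border 0 a Y
      ext x y
      refine Fin.cases ?_ (fun i => ?_) x <;> refine Fin.cases ?_ (fun j => ?_) y
      · exact hdiag _
      · rfl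
      · exact hZ _ _
      · rfl
    obtain ⟨h1, h2⟩ := adj_gen ih Y (fun i j => hZ _ _) (fun i => hdiag _)
    rw [hb, pfaffian_border, ← sum_adj Y a h2]
    refine (det_border 0 a Y).trans ?_
    rw [zero_mul, zero_add]

/-- Corollary: for a skew-symmetric matrix `Y` of odd size `m = 2k+1` and a symmetric
rank-1 matrix `M = (a_i a_j)`, `det(Y+M) = (Σ_i (−1)^{i−1} a_i Pf(Y(i)))²`, where
`Y(i)` arises from `Y` by deleting the `i`-th row and column.
(In 0-based indexing the sign `(−1)^{i−1}` of the 1-based statement becomes `(−1)^i`.) -/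
theorem det_skew_add_symm_rank_one_odd {R : Type*} [CommRing R] (k : ℕ)
    (Y : Matrix (Fin (2*k+1)) (Fin (2*k+1)) R)
    (hY : Yᵀ = -Y) (hdiag : ∀ i, Y i i = 0) (a : Fin (2*k+1) → R) :
    (Y + Matrix.of fun i j => a i * a j).det
      = (∑ i : Fin (2*k+1),
          (-1 : R)^(i:ℕ) * a i * pfaffian (Y.submatrix i.succAbove i.succAbove)) ^ 2 := by
  have hS : Skew Y := fun i j => congrFun (congrFun hY j) i
  obtain ⟨h1, h2⟩ := adj_gen (det_pf k) Y hS hdiag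
  rw [← det_border_one, det_border, h1, mul_zero, zero_add, sum_adj Y a h2]
end

section
/- Let m and n be positive integers, and let A and B be m×n matrices over a commutative ring. Then det(A·U_n·Bᵗ + B·U_n·Aᵗ + A·Bᵗ) = ( Σ_{1≤i_1≤j_1<i_2≤j_2<⋯≤n} det(A^{i_1} B^{j_1} A^{i_2} B^{j_2} ⋯) ) · ( Σ_{1≤i_1<j_1≤i_2<j_2≤⋯≤n} det(B^{i_1} A^{j_1} B^{i_2} A^{j_2} ⋯) ), where in each factor the concatenation consists of m columns alternating between the two matrices (so the last column is B^{j_{m/2}} or A^{i_{(m+1)/2}} in the first factor, and A^{j_{m/2}} or B^{i_{(m+1)/2}} in the second, depending on the parity of m), and the inequalities alternate as indicated: in the first factor i_k ≤ j_k and j_k < i_{k+1}, in the second factor i_k < j_k and j_k ≤ i_{k+1}. -/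
open Matrix

/-- The `n × n` strictly upper triangular matrix `U_n` with all entries above the
diagonal equal to `1` and all other entries equal to `0`. -/
def upperTri (R : Type*) [CommRing R] (n : ℕ) : Matrix (Fin n) (Fin n) R :=
  Matrix.of fun i j => if i < j then 1 else 0


namespace Byun
open ExteriorAlgebra

section
variable {R : Type*} [CommRing R] {M : Type*} [AddCommGroup M] [Module R M]

lemma anti (u v : M) : ι R u * ι R v = - (ι R v * ι R u) :=
  eq_neg_of_add_eq_zero_left (ι_add_mul_swap u v)

lemma q_mem (u v : M) : ι R u * ι R v ∈ Subalgebra.center R (ExteriorAlgebra R M) := by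
  rw [Subalgebra.mem_center_iff]
  intro b
  induction b using ExteriorAlgebra.induction with
  | algebraMap r => exact Algebra.commutes r _
  | ι x =>
    rw [← mul_assoc, anti x u, neg_mul, mul_assoc, anti x v, mul_neg, neg_neg, mul_assoc]
  | mul a b ha hb => rw [mul_assoc, hb, ← mul_assoc, ha, mul_assoc]
  | add a b ha hb => rw [add_mul, mul_add, ha, hb]

/-- the centre of the exterior algebra -/
def Z (R : Type*) [CommRing R] (M : Type*) [AddCommGroup M] [Module R M] : Type _ :=
  Subalgebra.center R (ExteriorAlgebra R M)

noncomputable instance : CommRing (Z R M) :=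
  inferInstanceAs (CommRing (Subalgebra.center R (ExteriorAlgebra R M)))

/-- the inclusion of the centre -/
def toE : Z R M →+* ExteriorAlgebra R M :=
  (Subalgebra.center R (ExteriorAlgebra R M)).val.toRingHom

lemma toE_inj {x y : Z R M} (h : toE x = toE y) : x = y := Subtype.ext h

lemma toE_comm (x : Z R M) (y : ExteriorAlgebra R M) : y * toE x = toE x * y :=
  (Subalgebra.mem_center_iff (R := R)).1 x.2 y

def q (R : Type*) [CommRing R] {M : Type*} [AddCommGroup M] [Module R M] (u v : M) : Z R M :=
  ⟨ι R u * ι R v, q_mem u v⟩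

lemma coe_q (u v : M) : toE (q R u v : Z R M) = ι R u * ι R v := rfl

lemma q_add_left (u v w : M) : q R (u + v) w = q R u w + q R v w := by
  apply toE_inj; simp [coe_q, add_mul]
lemma q_add_right (u v w : M) : q R u (v + w) = q R u v + q R u w := by
  apply toE_inj; simp [coe_q, mul_add]
lemma q_zero_left (w : M) : q R 0 w = 0 := by
  apply toE_inj; simp [coe_q]
lemma q_zero_right (w : M) : q R w 0 = 0 := by
  apply toE_inj; simp [coe_q]
lemma q_smul (c : R) (u w : M) : q R (c • u) w = q R u (c • w) := by
  apply toE_inj; simp [coe_q]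
lemma q_neg_left (u w : M) : q R (-u) w = q R u (-w) := by
  apply toE_inj; simp [coe_q]
lemma q_swap (u w : M) : q R u w = q R w (-u) := by
  apply toE_inj; simp [coe_q, anti u w]
lemma q_mul_left (u v w : M) : q R u v * q R u w = 0 := by
  apply toE_inj
  simp only [map_mul, coe_q, map_zero]
  rw [← mul_assoc, anti u v, neg_mul, mul_assoc (ι R v), ι_sq_zero]; simp
lemma q_mul_right (u v w : M) : q R v u * q R w u = 0 := by
  rw [q_swap v, q_swap w, q_mul_left]
lemma q_mul_swap (a b c d : M) : q R a b * q R c d = q R b c * q R a d := by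
  apply toE_inj
  simp only [map_mul, coe_q]
  have h := (Subalgebra.mem_center_iff (R := R)).1 (q_mem (R := R) b c) (ι R a)
  rw [← mul_assoc, ← mul_assoc, mul_assoc (ι R a), h]

noncomputable def ep (R : Type*) [CommRing R] {M : Type*} [AddCommGroup M] [Module R M] (u v : M) : Z R M :=
  1 + q R u v

lemma ep_add_right (u v w : M) : ep R u (v + w) = ep R u v * ep R u w := by
  have := q_mul_left (R := R) u v w
  unfold ep; rw [q_add_right]; linear_combination -this
lemma ep_add_left (u v w : M) : ep R (u + v) w = ep R u w * ep R v w := by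
  have := q_mul_right (R := R) w u v
  unfold ep; rw [q_add_left]; linear_combination -this
lemma ep_smul (c : R) (u w : M) : ep R (c • u) w = ep R u (c • w) := by
  unfold ep; rw [q_smul]
lemma ep_neg_left (u w : M) : ep R (-u) w = ep R u (-w) := by
  unfold ep; rw [q_neg_left]
lemma ep_swap (u w : M) : ep R u w = ep R w (-u) := by
  unfold ep; rw [q_swap]
lemma ep_zero_left (w : M) : ep R 0 w = 1 := by
  unfold ep; rw [q_zero_left, add_zero]
lemma ep_zero_right (w : M) : ep R w 0 = 1 := by
  unfold ep; rw [q_zero_right, add_zero]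

lemma ep_sum_left {κ : Type*} (s : Finset κ) (f : κ → M) (w : M) :
    ep R (∑ i ∈ s, f i) w = ∏ i ∈ s, ep R (f i) w := by
  classical
  induction s using Finset.induction_on with
  | empty => simp [ep_zero_left]
  | insert a s ha ih => rw [Finset.sum_insert ha, Finset.prod_insert ha, ep_add_left, ih]

lemma ep_sum_right {κ : Type*} (s : Finset κ) (f : κ → M) (w : M) :
    ep R w (∑ i ∈ s, f i) = ∏ i ∈ s, ep R w (f i) := by
  classical
  induction s using Finset.induction_on with
  | empty => simp [ep_zero_right]
  | insert a s ha ih => rw [Finset.sum_insert ha, Finset.prod_insert ha, ep_add_right, ih]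

/-- `∏ ep(x_j, w_j)` in terms of a basis -/
lemma prod_ep {κ : Type*} {m : ℕ} (s : Finset κ) (x : κ → Fin m → R) (e : Fin m → M) (w : κ → M) :
    ∏ j ∈ s, ep R (∑ r, x j r • e r) (w j) = ∏ r, ep R (e r) (∑ j ∈ s, x j r • w j) := by
  simp_rw [ep_sum_left, ep_sum_right, ep_smul]
  rw [Finset.prod_comm]

/-- partial sums -/
def ps (A : ℕ → M) (N : ℕ) : M := ∑ j ∈ Finset.range N, A j

lemma ps_succ (A : ℕ → M) (N : ℕ) : ps A (N+1) = ps A N + A N := Finset.sum_range_succ _ _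

variable (R) in
noncomputable def P (A B : ℕ → M) (N : ℕ) : Z R M := ∏ j ∈ Finset.range N, ep R (ps B j) (A j)
variable (R) in
noncomputable def P' (A B : ℕ → M) (N : ℕ) : Z R M := ∏ j ∈ Finset.range N, ep R (ps A (j+1)) (B j)

lemma P_succ (A B : ℕ → M) (N : ℕ) : P R A B (N+1) = P R A B N * ep R (ps B N) (A N) :=
  Finset.prod_range_succ _ _
lemma P'_succ (A B : ℕ → M) (N : ℕ) : P' R A B (N+1) = P' R A B N * ep R (ps A (N+1)) (B N) :=
  Finset.prod_range_succ _ _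

lemma P'_eq (A B : ℕ → M) (N : ℕ) : P' R A B N = P R A B N * ep R (ps A N) (ps B N) := by
  induction N with
  | zero => simp [P, P', ps, ep_zero_left]
  | succ N ih =>
    rw [P_succ, P'_succ, ih, mul_assoc, mul_assoc]
    congr 1
    have h : ep R (ps B N) (A N) * ep R (A N) (ps B N) = 1 := by
      rw [ep_swap (ps B N), ← ep_add_right, neg_add_cancel, ep_zero_right]
    rw [ps_succ A, ps_succ B, ep_add_right (ps A N + A N) (ps B N),
      ep_add_left (ps A N) (A N) (ps B N)]
    linear_combination (- ep R (ps A N) (ps B N) * ep R (ps A N + A N) (B N)) * h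

lemma ep_mul_self (a b : M) : toE (ep R a b) * ι R a = ι R a := by
  unfold ep
  rw [map_add, map_one, coe_q, add_mul, one_mul, mul_assoc, anti b a, mul_neg, ← mul_assoc,
    ι_sq_zero]; simp

lemma ep_mul_self' (a b : M) : toE (ep R a b) * ι R b = ι R b := by
  unfold ep
  rw [map_add, map_one, coe_q, add_mul, one_mul, mul_assoc, ι_sq_zero]; simp

lemma map_q {M' : Type*} [AddCommGroup M'] [Module R M'] (φ : M →ₗ[R] M') (u v : M) :
    ExteriorAlgebra.map φ (toE (q R u v)) = toE (q R (φ u) (φ v)) := by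
  rw [coe_q, coe_q, map_mul, map_apply_ι, map_apply_ι]

lemma map_ep {M' : Type*} [AddCommGroup M'] [Module R M'] (φ : M →ₗ[R] M') (u v : M) :
    ExteriorAlgebra.map φ (toE (ep R u v)) = toE (ep R (φ u) (φ v)) := by
  simp only [ep, map_add, map_one, map_q]

lemma map_ps {M' : Type*} [AddCommGroup M'] [Module R M'] (φ : M →ₗ[R] M') (A : ℕ → M) (N : ℕ) :
    φ (ps A N) = ps (fun j => φ (A j)) N := by
  simp [ps]

lemma map_P {M' : Type*} [AddCommGroup M'] [Module R M'] (φ : M →ₗ[R] M') (A B : ℕ → M) (N : ℕ) :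
    ExteriorAlgebra.map φ (toE (P R A B N)) = toE (P R (fun j => φ (A j)) (fun j => φ (B j)) N) := by
  induction N with
  | zero => simp [P]
  | succ N ih => rw [P_succ, P_succ, map_mul, map_mul, map_mul, ih, map_ep, map_ps]

lemma map_P' {M' : Type*} [AddCommGroup M'] [Module R M'] (φ : M →ₗ[R] M') (A B : ℕ → M) (N : ℕ) :
    ExteriorAlgebra.map φ (toE (P' R A B N)) =
      toE (P' R (fun j => φ (A j)) (fun j => φ (B j)) N) := by
  induction N with
  | zero => simp [P']
  | succ N ih => rw [P'_succ, P'_succ, map_mul, map_mul, map_mul, ih, map_ep, map_ps]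

lemma ps_neg (B : ℕ → M) (N : ℕ) : ps (fun j => - B j) N = - ps B N := by
  simp [ps]

/-- key identity -/
lemma key {m : ℕ} (A B : ℕ → Fin m → R) (N : ℕ) (i1 i2 : (Fin m → R) →ₗ[R] M) :
    P R (fun j => i1 (A j)) (fun j => i1 (B j)) N *
      P' R (fun j => i2 (A j)) (fun j => i2 (- B j)) N * ep R (i1 (ps A N)) (i2 (ps B N)) =
    ∏ r, ep R (i1 (Pi.single r 1) - i2 (Pi.single r 1))
      ((∑ j ∈ Finset.range N, ps B j r • i1 (A j)) +
       (∑ j ∈ Finset.range N, A j r • (- i2 (ps B j))) + ps A N r • i2 (ps B N)) := by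
  have he : ∀ x : Fin m → R, ∑ r, x r • (i1 (Pi.single r 1) - i2 (Pi.single r 1)) =
      i1 x - i2 x := by
    intro x
    have hx : x = ∑ r, x r • (Pi.single r (1:R) : Fin m → R) := by
      simpa using pi_eq_sum_univ' x
    conv_rhs => rw [hx]
    simp [smul_sub]
  simp_rw [ep_add_right, Finset.prod_mul_distrib, ← prod_ep]
  have h3 := prod_ep ({0} : Finset (Fin 1)) (fun _ => ps A N)
    (fun r => i1 (Pi.single r (1:R)) - i2 (Pi.single r 1)) (fun _ => i2 (ps B N))
  simp only [Finset.prod_singleton, Finset.sum_singleton] at h3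
  rw [← h3]
  simp_rw [he]
  rw [P'_eq, ← map_ps, ← map_ps, ps_neg]
  have h4 : ep R (i1 (ps A N) - i2 (ps A N)) (i2 (ps B N)) =
      ep R (i2 (ps A N)) (i2 (- ps B N)) * ep R (i1 (ps A N)) (i2 (ps B N)) := by
    rw [sub_eq_add_neg, ep_add_left, ep_neg_left, map_neg, mul_comm]
  rw [h4]
  have h5 : P R (fun j => i1 (A j)) (fun j => i1 (B j)) N *
     P R (fun j => i2 (A j)) (fun j => i2 (- B j)) N =
     (∏ j ∈ Finset.range N, ep R (i1 (ps B j) - i2 (ps B j)) (i1 (A j))) *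
     ∏ j ∈ Finset.range N, ep R (i1 (A j) - i2 (A j)) (- i2 (ps B j)) := by
    unfold P
    rw [← Finset.prod_mul_distrib, ← Finset.prod_mul_distrib]
    refine Finset.prod_congr rfl fun j _ => ?_
    beta_reduce
    rw [← map_ps, ← map_ps, ps_neg, map_neg, ep_neg_left, ← ep_swap (i2 (ps B j)) (i1 (A j) - i2 (A j)),
      sub_eq_add_neg (i1 (A j)), ep_add_right, ← mul_assoc, ← ep_add_left, sub_add_cancel]
  rw [← mul_assoc, ← mul_assoc, h5]

/-- alternating strictly increasing chains -/
noncomputable def chains (e p N : ℕ) : Finset (Fin p → ℕ) :=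
  (Fintype.piFinset fun _ : Fin p => Finset.range N).filter
    (fun c => StrictMono c ∧ ∀ s : Fin p, c s % 2 = (s.1 + e) % 2)

lemma mem_chains {e p N : ℕ} {c : Fin p → ℕ} : c ∈ chains e p N ↔
    (∀ s, c s < N) ∧ StrictMono c ∧ ∀ s : Fin p, c s % 2 = (s.1 + e) % 2 := by
  simp [chains]

variable (R) in
noncomputable def H (v : ℕ → M) (e p N : ℕ) : ExteriorAlgebra R M :=
  ∑ c ∈ chains e p N, ιMulti R p (fun s => v (c s))

lemma H_zero (v : ℕ → M) (e N : ℕ) : H R v e 0 N = 1 := by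
  have : chains e 0 N = {Fin.elim0} := by
    ext c
    simp only [mem_chains, Finset.mem_singleton]
    exact ⟨fun _ => Subsingleton.elim _ _, fun _ => ⟨fun s => s.elim0, fun s => s.elim0, fun s => s.elim0⟩⟩
  simp [H, this]

lemma H_succ_zero (v : ℕ → M) (e p : ℕ) : H R v e (p+1) 0 = 0 := by
  have : chains e (p+1) 0 = ∅ := by
    ext c
    simp only [mem_chains, Finset.notMem_empty, iff_false]
    intro h
    exact absurd (h.1 0) (by simp)
  simp [H, this]

lemma ιMulti_snoc {p : ℕ} (u : Fin p → M) (x : M) :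
    ιMulti R (p+1) (Fin.snoc u x : Fin (p+1) → M) = ιMulti R p u * ι R x := by
  rw [ιMulti_apply, ιMulti_apply, List.ofFn_succ']
  simp

lemma H_succ (v : ℕ → M) (e p N : ℕ) : H R v e (p+1) (N+1) = H R v e (p+1) N +
    if N % 2 = (p + e) % 2 then H R v e p N * ι R (v N) else 0 := by
  classical
  unfold H
  rw [← Finset.sum_filter_add_sum_filter_not (chains e (p+1) (N+1)) (fun c => c (Fin.last p) < N)]
  congr 1
  · refine Finset.sum_congr ?_ fun _ _ => rfl
    ext c
    simp only [Finset.mem_filter, mem_chains]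
    constructor
    · rintro ⟨⟨h1, h2, h3⟩, h4⟩
      exact ⟨fun s => lt_of_le_of_lt (h2.monotone (Fin.le_last s)) h4, h2, h3⟩
    · rintro ⟨h1, h2, h3⟩
      exact ⟨⟨fun s => (h1 s).trans (Nat.lt_succ_self _), h2, h3⟩, h1 _⟩
  · split_ifs with hN
    · rw [Finset.sum_mul]
      refine Finset.sum_bij' (fun c _ => fun s => c (Fin.castSucc s))
        (fun c _ => (Fin.snoc c N : Fin (p+1) → ℕ)) ?_ ?_ ?_ ?_ ?_
      · intro c hc
        simp only [Finset.mem_filter, mem_chains] at hc ⊢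
        obtain ⟨⟨h1, h2, h3⟩, h4⟩ := hc
        refine ⟨fun s => ?_, fun s t h => h2 (by simpa using h), fun s => by simpa using h3 s.castSucc⟩
        have := h2 (Fin.castSucc_lt_last s)
        have := h1 (Fin.last p)
        omega
      · intro c hc
        simp only [Finset.mem_filter, mem_chains] at hc ⊢
        obtain ⟨h1, h2, h3⟩ := hc
        refine ⟨⟨fun s => ?_, fun s t h => ?_, fun s => ?_⟩, ?_⟩
        · refine Fin.lastCases ?_ (fun s => ?_) s
          · simp
          · simpa using (h1 s).trans (Nat.lt_succ_self _)
        · revert h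
          refine Fin.lastCases ?_ (fun t => ?_) t
          · refine Fin.lastCases ?_ (fun s => ?_) s
            · simp
            · intro _; simpa using h1 s
          · refine Fin.lastCases ?_ (fun s => ?_) s
            · intro h; exact absurd h (not_lt.2 (Fin.le_last _))
            · intro h; simpa using h2 (by simpa using h)
        · refine Fin.lastCases ?_ (fun s => ?_) s
          · simpa using hN
          · simpa using h3 s
        · simp
      · intro c hc
        simp only [Finset.mem_filter, mem_chains] at hc
        obtain ⟨⟨h1, h2, h3⟩, h4⟩ := hc
        have := h1 (Fin.last p)
        funext s
        refine Fin.lastCases ?_ (fun s => ?_) s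
        · simp; omega
        · simp
      · intro c hc
        funext s; simp
      · intro c hc
        simp only [Finset.mem_filter, mem_chains] at hc
        obtain ⟨⟨h1, h2, h3⟩, h4⟩ := hc
        have := h1 (Fin.last p)
        rw [← ιMulti_snoc]
        congr 1
        funext s
        refine Fin.lastCases ?_ (fun s => ?_) s
        · simp only [Fin.snoc_last]; congr 1; omega
        · simp
    · refine Finset.sum_eq_zero fun c hc => ?_
      exfalso
      simp only [Finset.mem_filter, mem_chains] at hc
      obtain ⟨⟨h1, h2, h3⟩, h4⟩ := hc
      have h5 := h1 (Fin.last p)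
      have h6 := h3 (Fin.last p)
      have h7 : c (Fin.last p) = N := by omega
      rw [h7] at h6
      exact hN (by simpa using h6)

lemma H_big (v : ℕ → M) (e N : ℕ) : ∀ p, N < p → H R v e p N = 0 := by
  induction N with
  | zero => intro p hp; obtain ⟨p, rfl⟩ : ∃ k, p = k + 1 := ⟨p - 1, by omega⟩; exact H_succ_zero _ _ _
  | succ N ih =>
    intro p hp
    obtain ⟨p, rfl⟩ : ∃ k, p = k + 1 := ⟨p - 1, by omega⟩
    rw [H_succ, ih _ (by omega), ih p (by omega)]; simp

variable (R) in
noncomputable def Et (v : ℕ → M) (e L N : ℕ) : ExteriorAlgebra R M :=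
  ∑ k ∈ Finset.range (L+1), H R v e (2*k) N
variable (R) in
noncomputable def Ot (v : ℕ → M) (e L N : ℕ) : ExteriorAlgebra R M :=
  ∑ k ∈ Finset.range (L+1), H R v e (2*k+1) N

lemma Ot_succ (v : ℕ → M) (e L N : ℕ) : Ot R v e L (N+1) = Ot R v e L N +
    if N % 2 = e % 2 then Et R v e L N * ι R (v N) else 0 := by
  unfold Ot Et
  simp_rw [H_succ]
  rw [Finset.sum_add_distrib]
  congr 1
  split_ifs with h
  · rw [Finset.sum_mul]
    refine Finset.sum_congr rfl fun k _ => if_pos (by omega)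
  · exact Finset.sum_eq_zero fun k _ => if_neg (by omega)

lemma Et_succ (v : ℕ → M) (e L N : ℕ) (hN : N < 2*L+1) : Et R v e L (N+1) = Et R v e L N +
    if N % 2 = e % 2 then 0 else Ot R v e L N * ι R (v N) := by
  unfold Ot Et
  rw [Finset.sum_range_succ', Finset.sum_range_succ' _ L, Finset.sum_range_succ _ L,
    H_big v e N (2*L+1) hN]
  simp_rw [show ∀ k, 2*(k+1) = (2*k+1)+1 from fun k => by ring, H_succ, mul_zero, H_zero, add_zero]
  rw [Finset.sum_add_distrib, add_right_comm]
  congr 1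
  split_ifs with h
  · exact Finset.sum_eq_zero fun k _ => if_neg (by omega)
  · rw [Finset.sum_mul]
    refine Finset.sum_congr rfl fun k _ => if_pos (by omega)

lemma Et_zero (v : ℕ → M) (e L : ℕ) : Et R v e L 0 = 1 := by
  unfold Et
  rw [Finset.sum_range_succ', Finset.sum_eq_zero, mul_zero, H_zero, zero_add]
  intro _ _; exact H_succ_zero _ _ _
lemma Ot_zero (v : ℕ → M) (e L : ℕ) : Ot R v e L 0 = 0 :=
  Finset.sum_eq_zero fun k _ => H_succ_zero _ _ _

/-- interleave -/
def il (A B : ℕ → M) (k : ℕ) : M := if k % 2 = 0 then A (k/2) else B (k/2)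

lemma il_even (A B : ℕ → M) (k : ℕ) : il A B (2*k) = A k := by
  unfold il; rw [if_pos (by omega)]; congr 1; omega
lemma il_odd (A B : ℕ → M) (k : ℕ) : il A B (2*k+1) = B k := by
  unfold il; rw [if_neg (by omega)]; congr 1; omega

lemma closed0 (A B : ℕ → M) (L N : ℕ) (h : N ≤ L) :
    Et R (il A B) 0 L (2*N) = toE (P' R A B N) ∧
    Ot R (il A B) 0 L (2*N) = toE (P' R A B N) * ι R (ps A N) := by
  induction N with
  | zero => simp [Et_zero, Ot_zero, P', ps]
  | succ N ih =>
    obtain ⟨h1, h2⟩ := ih (by omega)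
    have e1 : Et R (il A B) 0 L (2*N+1) = toE (P' R A B N) := by
      rw [Et_succ _ _ _ _ (by omega), if_pos (by omega), add_zero, h1]
    have o1 : Ot R (il A B) 0 L (2*N+1) = toE (P' R A B N) * ι R (ps A (N+1)) := by
      rw [Ot_succ, if_pos (by omega), h1, h2, ps_succ, il_even, map_add, mul_add]
    rw [show 2*(N+1) = 2*N+1+1 by ring, Et_succ _ _ _ _ (by omega), if_neg (by omega),
      Ot_succ _ _ _ (2*N+1), if_neg (by omega), e1, o1, P'_succ, map_mul, il_odd, mul_assoc, mul_assoc, ep_mul_self]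
    refine ⟨?_, by simp⟩
    unfold ep
    rw [map_add, map_one, mul_add, mul_one, coe_q]

lemma closed1 (A B : ℕ → M) (L N : ℕ) (h : N ≤ L) :
    Et R (il A B) 1 L (2*N) = toE (P R A B N) ∧
    Ot R (il A B) 1 L (2*N) = toE (P R A B N) * ι R (ps B N) := by
  induction N with
  | zero => simp [Et_zero, Ot_zero, P, ps]
  | succ N ih =>
    obtain ⟨h1, h2⟩ := ih (by omega)
    have e1 : Et R (il A B) 1 L (2*N+1) = toE (P R A B (N+1)) := by
      rw [Et_succ _ _ _ _ (by omega), if_neg (by omega), h1, h2, P_succ, il_even, map_mul]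
      unfold ep
      rw [map_add, map_one, mul_add, mul_one, coe_q, mul_assoc]
    have o1 : Ot R (il A B) 1 L (2*N+1) = toE (P R A B (N+1)) * ι R (ps B N) := by
      rw [Ot_succ, if_neg (by omega), h2, P_succ, add_zero, map_mul, mul_assoc, ep_mul_self]
    rw [show 2*(N+1) = 2*N+1+1 by ring, Et_succ _ _ _ _ (by omega), if_pos (by omega), Ot_succ,
      if_pos (by omega), e1, o1, il_odd, ps_succ, map_add, mul_add]
    simp

variable (R) in
/-- determinant functional on the exterior algebra -/
noncomputable def Dg {κ : Type*} [Fintype κ] [DecidableEq κ] {k : ℕ} (τ : κ ≃ Fin k) :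
    ExteriorAlgebra R (κ → R) →ₗ[R] R :=
  liftAlternating (Pi.single k (Matrix.detRowAlternating.domDomCongr τ))

lemma Dg_same {κ : Type*} [Fintype κ] [DecidableEq κ] {k : ℕ} (τ : κ ≃ Fin k)
    (v : Fin k → κ → R) : Dg R τ (ιMulti R k v) = (Matrix.of fun i => v (τ i)).det := by
  rw [Dg, liftAlternating_apply_ιMulti, Pi.single_eq_same]
  rfl

lemma Dg_ne {κ : Type*} [Fintype κ] [DecidableEq κ] {k p : ℕ} (τ : κ ≃ Fin k) (hp : p ≠ k)
    (v : Fin p → κ → R) : Dg R τ (ιMulti R p v) = 0 := by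
  rw [Dg, liftAlternating_apply_ιMulti, Pi.single_eq_of_ne hp]
  rfl

lemma ιMulti_big {m p : ℕ} (h : m < p) (v : Fin p → Fin m → R) : ιMulti R p v = 0 := by
  have : (ιMulti R p : (Fin m → R) [⋀^Fin p]→ₗ[R] _) = 0 := by
    refine Module.Basis.ext_alternating (Pi.basisFun R (Fin m)) fun f hf => ?_
    have := Fintype.card_le_of_injective f hf
    simp at this
    omega
  rw [this]; rfl

variable (R) in
noncomputable def i1 (m : ℕ) : (Fin m → R) →ₗ[R] (Fin m ⊕ Fin m → R) where
  toFun v := Sum.elim v 0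
  map_add' u v := by ext (i | i) <;> simp
  map_smul' u v := by ext (i | i) <;> simp
variable (R) in
noncomputable def i2 (m : ℕ) : (Fin m → R) →ₗ[R] (Fin m ⊕ Fin m → R) where
  toFun v := Sum.elim 0 v
  map_add' u v := by ext (i | i) <;> simp
  map_smul' u v := by ext (i | i) <;> simp

variable (R) in
noncomputable abbrev D (m : ℕ) := Dg R (Equiv.refl (Fin m))
variable (R) in
noncomputable abbrev T (m : ℕ) := Dg R (finSumFinEquiv : Fin m ⊕ Fin m ≃ Fin (m + m))

lemma ιMulti_append {p r : ℕ} (u : Fin p → M) (w : Fin r → M) :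
    ιMulti R p u * ιMulti R r w = ιMulti R (p + r) (Fin.append u w) := by
  rw [ιMulti_apply, ιMulti_apply, ιMulti_apply, ← List.prod_append, ← List.ofFn_fin_append]
  congr 2
  funext i
  refine Fin.addCases (fun i => ?_) (fun i => ?_) i <;> simp

lemma T_append {m : ℕ} (u w : Fin m → (Fin m ⊕ Fin m → R)) :
    T R m (ιMulti R m u * ιMulti R m w) =
      (Matrix.fromBlocks (Matrix.of fun i j => u i (Sum.inl j)) (Matrix.of fun i j => u i (Sum.inr j))
        (Matrix.of fun i j => w i (Sum.inl j)) (Matrix.of fun i j => w i (Sum.inr j))).det := by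
  rw [ιMulti_append, Dg_same]
  congr 1
  have h1 : ∀ i : Fin m, Fin.append u w (finSumFinEquiv (Sum.inl i)) = u i := fun i => by
    rw [finSumFinEquiv_apply_left, Fin.append_left]
  have h2 : ∀ i : Fin m, Fin.append u w (finSumFinEquiv (Sum.inr i)) = w i := fun i => by
    rw [finSumFinEquiv_apply_right, Fin.append_right]
  ext (i | i) (j | j)
  · exact congrFun (h1 i) _
  · exact congrFun (h1 i) _
  · exact congrFun (h2 i) _
  · exact congrFun (h2 i) _

lemma T_mul {m : ℕ} (x y : ExteriorAlgebra R (Fin m → R)) :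
    T R m (ExteriorAlgebra.map (i1 R m) x * ExteriorAlgebra.map (i2 R m) y) = D R m x * D R m y := by
  suffices h : (T R m) ∘ₗ (LinearMap.mulRight R (ExteriorAlgebra.map (i2 R m) y)) ∘ₗ
      (ExteriorAlgebra.map (i1 R m)).toLinearMap = (D R m y) • (D R m) by
    have := LinearMap.congr_fun h x
    simpa [mul_comm] using this
  refine lhom_ext fun p => ?_
  ext u
  simp only [LinearMap.compAlternatingMap_apply, LinearMap.comp_apply, AlgHom.toLinearMap_apply,
    LinearMap.mulRight_apply, LinearMap.smul_apply, smul_eq_mul]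
  rw [mul_comm]
  suffices h : (T R m) ∘ₗ (LinearMap.mulLeft R (ExteriorAlgebra.map (i1 R m) (ιMulti R p u))) ∘ₗ
      (ExteriorAlgebra.map (i2 R m)).toLinearMap = (D R m (ιMulti R p u)) • (D R m) by
    have := LinearMap.congr_fun h y
    simpa using this
  refine lhom_ext fun r => ?_
  ext w
  simp only [LinearMap.compAlternatingMap_apply, LinearMap.comp_apply, AlgHom.toLinearMap_apply,
    LinearMap.mulLeft_apply, LinearMap.smul_apply, smul_eq_mul]
  by_cases hp : m < p
  · rw [ιMulti_big hp]; simp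
  by_cases hr : m < r
  · rw [ιMulti_big hr]; simp
  by_cases hpm : p = m
  · subst hpm
    by_cases hrm : r = p
    · subst hrm
      rw [map_apply_ιMulti, map_apply_ιMulti, T_append, Dg_same, Dg_same]
      have h1 : (Matrix.of fun i j => ((i1 R r) ∘ u) i (Sum.inr j)) = 0 := by
        ext i j; simp [i1]
      rw [h1, Matrix.det_fromBlocks_zero₁₂]
      rfl
    · rw [map_apply_ιMulti, map_apply_ιMulti, ιMulti_append, Dg_ne _ (by omega),
        Dg_ne _ hrm, mul_zero]
  · rw [map_apply_ιMulti, map_apply_ιMulti, ιMulti_append, Dg_ne _ (by omega), Dg_ne _ hpm, zero_mul]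

lemma prod_q_eq {κ : Type*} [DecidableEq κ] (s : Finset κ) (e w : κ → M) :
    ∃ v : Fin (2 * s.card) → M, toE (∏ r ∈ s, q R (e r) (w r)) = ιMulti R _ v := by
  suffices h : ∃ (k : ℕ) (_ : k = 2 * s.card) (v : Fin k → M),
      toE (∏ r ∈ s, q R (e r) (w r)) = ιMulti R _ v by
    obtain ⟨k, rfl, v, hv⟩ := h; exact ⟨v, hv⟩
  induction s using Finset.induction_on with
  | empty => exact ⟨0, by simp, Fin.elim0, by simp⟩
  | insert a s ha ih =>
    obtain ⟨k, hk, v, hv⟩ := ih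
    refine ⟨k+1+1, by rw [Finset.card_insert_of_notMem ha]; omega,
      Fin.snoc (Fin.snoc v (e a) : Fin (k+1) → M) (w a), ?_⟩
    rw [Finset.prod_insert ha, mul_comm, map_mul, hv, ιMulti_snoc, ιMulti_snoc, coe_q, mul_assoc]

lemma ιMulti_comm_ι {p : ℕ} (u : Fin p → M) (x : M) :
    ιMulti R p u * ι R x = (-1) ^ p * (ι R x * ιMulti R p u) := by
  induction p with
  | zero => simp
  | succ p ih =>
    rw [ιMulti_succ_apply, mul_assoc, ih, pow_succ, ← mul_assoc (ι R x), anti x]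
    have : ι R (u 0) * ((-1)^p * (ι R x * ιMulti R p (Matrix.vecTail u))) =
      (-1)^p * (ι R (u 0) * (ι R x * ιMulti R p (Matrix.vecTail u))) := by
      rw [← mul_assoc, ← ((Commute.neg_one_left (ι R (u 0))).pow_left p).eq, mul_assoc]
    rw [this]
    simp [mul_assoc]

lemma prod_q_sign {m : ℕ} (e w : Fin m → M) :
    toE (∏ r, q R (e r) (w r)) = (-1) ^ (m/2) * (ιMulti R m e * ιMulti R m w) := by
  induction m with
  | zero => simp
  | succ m ih =>
    have he : e = Fin.snoc (fun i => e (Fin.castSucc i)) (e (Fin.last m)) := by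
      exact (Fin.snoc_init_self e).symm
    have hw : w = Fin.snoc (fun i => w (Fin.castSucc i)) (w (Fin.last m)) := by
      exact (Fin.snoc_init_self w).symm
    rw [Fin.prod_univ_castSucc, map_mul, ih, coe_q]
    conv_rhs => rw [he, hw, ιMulti_snoc, ιMulti_snoc]
    set E := ιMulti R m fun i => e (Fin.castSucc i)
    have hs : ((-1 : ExteriorAlgebra R M)) ^ (m/2) * (-1)^m = (-1)^((m+1)/2) := by
      rw [← pow_add]
      rcases Nat.even_or_odd' m with ⟨k, rfl | rfl⟩
      · rw [show (2*k)/2 + 2*k = (2*k+1)/2 + 2*k by omega, pow_add, pow_mul (-1 : ExteriorAlgebra R M) 2 k]; simp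
      · rw [show (2*k+1)/2 + (2*k+1) = (2*k+1+1)/2 + 2*k by omega, pow_add, pow_mul (-1 : ExteriorAlgebra R M) 2 k]; simp
    rw [← hs]
    have h2 := ιMulti_comm_ι (R := R) (fun i => w (Fin.castSucc i)) (e (Fin.last m))
    set W := ιMulti R m fun i => w (Fin.castSucc i)
    have hc : E * (-1)^m = (-1)^m * E := (((Commute.neg_one_left E).pow_left m).eq).symm
    calc _ = (-1)^(m/2) * (E * (W * ι R (e (Fin.last m))) * ι R (w (Fin.last m))) := by
            simp only [mul_assoc]
      _ = (-1)^(m/2) * (E * (-1)^m * (ι R (e (Fin.last m)) * W) * ι R (w (Fin.last m))) := by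
            rw [h2]; simp only [mul_assoc]
      _ = _ := by rw [hc]; simp only [mul_assoc]

lemma T_prod {m : ℕ} (e w : Fin m → (Fin m ⊕ Fin m → R)) :
    T R m (toE (∏ r, ep R (e r) (w r))) = (-1) ^ (m/2) * T R m (ιMulti R m e * ιMulti R m w) := by
  unfold ep
  rw [Finset.prod_one_add, map_sum, map_sum, Finset.sum_eq_single Finset.univ]
  · rw [prod_q_sign]
    have : ((-1 : ExteriorAlgebra R (Fin m ⊕ Fin m → R)) ^ (m/2)) = algebraMap R _ ((-1)^(m/2)) := by
      simp
    rw [this, ← Algebra.smul_def, map_smul, smul_eq_mul]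
  · intro s _ hs
    obtain ⟨v, hv⟩ := prod_q_eq (R := R) s e w
    rw [hv, Dg_ne]
    have := (Finset.card_lt_iff_ne_univ s).2 hs
    simp at this
    omega
  · simp

/-- evaluation of the right hand side of `key` -/
lemma det_key {m : ℕ} (A B : ℕ → Fin m → R) (N : ℕ) :
    T R m (toE (P R (fun j => i1 R m (A j)) (fun j => i1 R m (B j)) N *
      P' R (fun j => i2 R m (A j)) (fun j => i2 R m (- B j)) N *
        ep R (i1 R m (ps A N)) (i2 R m (ps B N)))) =
    (-1)^(m/2) * (Matrix.of fun r s : Fin m => ∑ j ∈ Finset.range N, (ps B j r * A j s - A j r * ps B j s) +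
      ps A N r * ps B N s).det := by
  rw [key, T_prod, T_append]
  congr 1
  have h1 : (Matrix.of fun i j : Fin m => (i1 R m (Pi.single i 1) - i2 R m (Pi.single i 1)) (Sum.inl j))
    = 1 := by ext i j; simp [i1, i2, Matrix.one_apply, Pi.single_apply, eq_comm]
  have h2 : (Matrix.of fun i j : Fin m => (i1 R m (Pi.single i 1) - i2 R m (Pi.single i 1)) (Sum.inr j))
    = -1 := by ext i j; simp [i1, i2, Matrix.one_apply, Pi.single_apply, eq_comm]
  rw [h1, h2, Matrix.det_fromBlocks_one₁₁, mul_neg, mul_one, sub_neg_eq_add]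
  congr 1
  ext r s
  simp [i1, i2, Finset.sum_sub_distrib]
  ring

lemma main_alg {m : ℕ} (A B : ℕ → Fin m → R) (N : ℕ) :
    (-1)^(m/2) * (Matrix.of fun r s : Fin m => ∑ j ∈ Finset.range N, (ps B j r * A j s - A j r * ps B j s) +
      ps A N r * ps B N s).det =
    D R m (toE (P R A B N)) * D R m (toE (P' R A (fun j => - B j) N)) +
    D R m (toE (P R A B N) * ι R (ps A N)) * D R m (toE (P' R A (fun j => - B j) N) * ι R (ps B N)) := by
  rw [← det_key, ← T_mul, ← T_mul, ← map_add]
  congr 1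
  rw [map_mul, map_mul, map_mul, map_mul, map_P, map_P', map_apply_ι, map_apply_ι]
  unfold ep
  rw [map_add, map_one, mul_add, mul_one, coe_q]
  congr 1
  set X := toE (P R (fun j => i1 R m (A j)) (fun j => i1 R m (B j)) N)
  simp only [mul_assoc]
  congr 1
  rw [← mul_assoc (ι R (i1 R m (ps A N))), toE_comm, mul_assoc]

lemma D_H_ne {m : ℕ} (v : ℕ → Fin m → R) (e p N : ℕ) (h : p ≠ m) : D R m (H R v e p N) = 0 := by
  unfold H
  rw [map_sum]
  exact Finset.sum_eq_zero fun c _ => Dg_ne _ h _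

lemma D_Et_odd {m : ℕ} (v : ℕ → Fin m → R) (e L N : ℕ) (h : m % 2 = 1) :
    D R m (Et R v e L N) = 0 := by
  unfold Et
  rw [map_sum]
  exact Finset.sum_eq_zero fun c _ => D_H_ne _ _ _ _ (by omega)

lemma D_Ot_even {m : ℕ} (v : ℕ → Fin m → R) (e L N : ℕ) (h : m % 2 = 0) :
    D R m (Ot R v e L N) = 0 := by
  unfold Ot
  rw [map_sum]
  exact Finset.sum_eq_zero fun c _ => D_H_ne _ _ _ _ (by omega)

lemma D_Et_even {m : ℕ} (v : ℕ → Fin m → R) (e L N : ℕ) (h : m % 2 = 0) (hL : m ≤ L) :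
    D R m (Et R v e L N) = D R m (H R v e m N) := by
  unfold Et
  rw [map_sum, Finset.sum_eq_single (m/2)]
  · rw [show 2 * (m/2) = m by omega]
  · exact fun c _ _ => D_H_ne _ _ _ _ (by omega)
  · intro hh; simp at hh; omega

lemma D_Ot_odd {m : ℕ} (v : ℕ → Fin m → R) (e L N : ℕ) (h : m % 2 = 1) (hL : m ≤ L) :
    D R m (Ot R v e L N) = D R m (H R v e m N) := by
  unfold Ot
  rw [map_sum, Finset.sum_eq_single (m/2)]
  · rw [show 2 * (m/2) + 1 = m by omega]
  · exact fun c _ _ => D_H_ne _ _ _ _ (by omega)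
  · intro hh; simp at hh; omega

/-- columns of a matrix, extended by zero -/
def co {m n : ℕ} (A : Matrix (Fin m) (Fin n) R) (j : ℕ) : Fin m → R :=
  fun r => if h : j < n then A r ⟨j, h⟩ else 0

/-- the two factors -/
noncomputable def Fs {m n : ℕ} (e : ℕ) (A B : Matrix (Fin m) (Fin n) R) : R :=
  ∑ d ∈ Finset.univ.filter (fun d : Fin m → Fin n =>
          ∀ s t : Fin m, (s:ℕ) + 1 = (t:ℕ) →
            (((s:ℕ) + e) % 2 = 0 → d s ≤ d t) ∧ (((s:ℕ) + e) % 2 = 1 → d s < d t)),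
        (Matrix.of fun r c : Fin m =>
          if ((c:ℕ) + e) % 2 = 0 then A r (d c) else B r (d c)).det

lemma sign_prod (e m : ℕ) (he : e < 2) :
    ∏ c : Fin m, (if ((c:ℕ) + e) % 2 = 0 then (1:R) else -1) = (-1) ^ ((m+e)/2) := by
  induction m with
  | zero => rw [show (0+e)/2 = 0 by omega]; simp
  | succ m ih =>
    rw [Fin.prod_univ_castSucc]
    simp only [Fin.val_castSucc, Fin.val_last]
    rw [ih]
    split_ifs with h
    · rw [mul_one]; congr 1; omega
    · rw [← pow_succ]; congr 1; omega

lemma Fs_neg {m n : ℕ} (e : ℕ) (he : e < 2) (A B : Matrix (Fin m) (Fin n) R) :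
    Fs e A (-B) = (-1) ^ ((m+e)/2) * Fs e A B := by
  unfold Fs
  rw [Finset.mul_sum]
  refine Finset.sum_congr rfl fun d _ => ?_
  rw [← sign_prod e m he, ← Matrix.det_mul_row]
  congr 1
  ext r c
  simp only [Matrix.of_apply]
  split_ifs <;> simp

lemma D_H {m n : ℕ} (e : ℕ) (he : e < 2) (A B : Matrix (Fin m) (Fin n) R) :
    D R m (H R (il (co A) (co B)) e m (2*n)) = Fs e A B := by
  unfold H Fs
  rw [map_sum]
  symm
  refine Finset.sum_bij (fun d _ => fun s : Fin m => 2 * (d s : ℕ) + ((s:ℕ) + e) % 2) ?_ ?_ ?_ ?_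
  · intro d hd
    simp only [Finset.mem_filter, Finset.mem_univ, true_and] at hd
    rw [mem_chains]
    refine ⟨fun s => by have := (d s).2; omega, ?_, fun s => by omega⟩
    cases m with
    | zero => exact fun s => s.elim0
    | succ m =>
      rw [Fin.strictMono_iff_lt_succ]
      intro s
      have h := hd s.castSucc s.succ (by simp)
      simp only [Fin.val_castSucc, Fin.val_succ, Fin.le_def, Fin.lt_def] at h ⊢
      omega
  · intro d _ d' _ h
    funext s
    have := congrFun h s
    apply Fin.ext
    beta_reduce at this
    omega
  · intro c hc
    rw [mem_chains] at hc
    obtain ⟨h1, h2, h3⟩ := hc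
    refine ⟨fun s => ⟨c s / 2, by have := h1 s; omega⟩, ?_, ?_⟩
    · simp only [Finset.mem_filter, Finset.mem_univ, true_and, Fin.le_def, Fin.lt_def]
      intro s t hst
      have h4 : c s < c t := h2 (by rw [Fin.lt_def]; omega)
      have h5 := h3 s
      have h6 := h3 t
      omega
    · funext s
      have h5 := h3 s
      simp only
      omega
  · intro d _
    rw [Dg_same, ← Matrix.det_transpose]
    congr 1
    ext c r
    simp only [Matrix.transpose_apply, Matrix.of_apply, Equiv.refl_apply]
    by_cases h : ((c:ℕ) + e) % 2 = 0
    · rw [if_pos h, h, add_zero, il_even]; simp [co]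
    · rw [if_neg h, show ((c:ℕ) + e) % 2 = 1 by omega, il_odd]; simp [co]

lemma co_neg {m n : ℕ} (B : Matrix (Fin m) (Fin n) R) : (fun j => - co B j) = co (-B) := by
  funext j r
  simp only [co, Pi.neg_apply, Matrix.neg_apply]
  split_ifs <;> simp

lemma final_alg {m n : ℕ} (A B : Matrix (Fin m) (Fin n) R) :
    (-1)^(m/2) * (Matrix.of fun r s : Fin m =>
      ∑ j ∈ Finset.range n, (ps (co B) j r * co A j s - co A j r * ps (co B) j s) +
      ps (co A) n r * ps (co B) n s).det = (-1)^(m/2) * (Fs 0 A B * Fs 1 A B) := by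
  rw [main_alg]
  have hPa : toE (P R (co A) (co B) n) * ι R (ps (co A) n) =
      toE (P' R (co A) (co B) n) * ι R (ps (co A) n) := by
    rw [P'_eq, map_mul, mul_assoc, ep_mul_self]
  have hPb : toE (P' R (co A) (fun j => - co B j) n) * ι R (ps (co B) n) =
      - (toE (P R (co A) (co (-B)) n) * ι R (ps (co (-B)) n)) := by
    rw [P'_eq, map_mul, mul_assoc, ps_neg, ← co_neg, ps_neg, map_neg, mul_neg, neg_neg]
    congr 1
    have := ep_mul_self' (R := R) (ps (co A) n) (- ps (co B) n)
    rw [map_neg, mul_neg] at this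
    exact neg_injective this
  rw [hPa, hPb, co_neg, map_neg]
  have a0 := closed0 (R := R) (co A) (co B) (n+m) n (by omega)
  have a1 := closed0 (R := R) (co A) (co (-B)) (n+m) n (by omega)
  have b0 := closed1 (R := R) (co A) (co B) (n+m) n (by omega)
  have b1 := closed1 (R := R) (co A) (co (-B)) (n+m) n (by omega)
  rw [← a0.2, ← a1.1, ← b0.1, ← b1.2]
  rcases Nat.mod_two_eq_zero_or_one m with h | h
  · rw [D_Et_even _ _ _ _ h (by omega), D_Et_even _ _ _ _ h (by omega), D_Ot_even _ _ _ _ h,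
      D_H _ (by omega), D_H _ (by omega), Fs_neg _ (by omega)]
    rw [add_zero]; ring
  · rw [D_Ot_odd _ _ _ _ h (by omega), D_Ot_odd _ _ _ _ h (by omega), D_Et_odd _ _ _ _ h,
      D_H _ (by omega), D_H _ (by omega), Fs_neg _ (by omega), show (m+1)/2 = m/2+1 by omega]
    ring

lemma sum_id {m : ℕ} (A B : ℕ → Fin m → R) (N : ℕ) (r s : Fin m) :
    ∑ j ∈ Finset.range N, (ps A j r * B j s + ps B j r * A j s + A j r * B j s) =
    ∑ j ∈ Finset.range N, (ps B j r * A j s - A j r * ps B j s) + ps A N r * ps B N s := by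
  induction N with
  | zero => simp [ps]
  | succ N ih =>
    rw [Finset.sum_range_succ, Finset.sum_range_succ, ih, ps_succ, ps_succ]
    simp only [Pi.add_apply]
    ring

end
end Byun

namespace Byun

lemma mul_upperTri {R : Type*} [CommRing R] {m n : ℕ} (A : Matrix (Fin m) (Fin n) R)
    (r : Fin m) (j : Fin n) : (A * upperTri R n) r j = ps (co A) j r := by
  rw [Matrix.mul_apply]
  simp only [upperTri, Matrix.of_apply, mul_ite, mul_one, mul_zero, ps, Finset.sum_apply]
  rw [← Finset.sum_filter]
  have h1 : Finset.range (j:ℕ) = (Finset.range n).filter (fun i => i < (j:ℕ)) := by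
    ext i; simp only [Finset.mem_range, Finset.mem_filter]; have := j.2; omega
  rw [h1, Finset.sum_filter, Finset.sum_filter, Finset.sum_range]
  refine Finset.sum_congr rfl fun i _ => ?_
  simp [co]

lemma mat_eq {R : Type*} [CommRing R] {m n : ℕ} (A B : Matrix (Fin m) (Fin n) R) :
    A * upperTri R n * Bᵀ + B * upperTri R n * Aᵀ + A * Bᵀ =
    Matrix.of fun r s : Fin m =>
      ∑ j ∈ Finset.range n, (ps (co B) j r * co A j s - co A j r * ps (co B) j s) +
      ps (co A) n r * ps (co B) n s := by
  ext r s
  rw [Matrix.of_apply, ← sum_id, Finset.sum_range, Matrix.add_apply, Matrix.add_apply,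
    Matrix.mul_apply, Matrix.mul_apply (M := B * _), Matrix.mul_apply (M := A),
    ← Finset.sum_add_distrib, ← Finset.sum_add_distrib]
  refine Finset.sum_congr rfl fun j _ => ?_
  rw [mul_upperTri, mul_upperTri]
  simp [co]

end Byun

/-- Asymmetric extension of Byun's minor summation formula:
`det(A·U_n·Bᵗ + B·U_n·Aᵗ + A·Bᵗ)
  = (Σ_{1≤i_1≤j_1<i_2≤j_2<⋯≤n} det(A^{i_1} B^{j_1} A^{i_2} B^{j_2} ⋯))
  · (Σ_{1≤i_1<j_1≤i_2<j_2≤⋯≤n} det(B^{i_1} A^{j_1} B^{i_2} A^{j_2} ⋯))`.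
Each summand is indexed by the sequence `d` of the `m` column indices
`i_1, j_1, i_2, j_2, …` (so in the first factor `d` must satisfy `d_s ≤ d_{s+1}` for
even positions `s` and `d_s < d_{s+1}` for odd positions `s`, 0-based, and the columns
at even positions are taken from `A`, those at odd positions from `B`; in the second
factor the roles are interchanged). -/
theorem det_asym_byun {R : Type*} [CommRing R] (m n : ℕ) (hm : 0 < m) (hn : 0 < n)
    (A B : Matrix (Fin m) (Fin n) R) :
    (A * upperTri R n * Bᵀ + B * upperTri R n * Aᵀ + A * Bᵀ).det =
      (∑ d ∈ Finset.univ.filter (fun d : Fin m → Fin n =>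
          ∀ s t : Fin m, (s:ℕ) + 1 = (t:ℕ) →
            ((s:ℕ) % 2 = 0 → d s ≤ d t) ∧ ((s:ℕ) % 2 = 1 → d s < d t)),
        (Matrix.of fun r c : Fin m =>
          if (c:ℕ) % 2 = 0 then A r (d c) else B r (d c)).det) *
      (∑ d ∈ Finset.univ.filter (fun d : Fin m → Fin n =>
          ∀ s t : Fin m, (s:ℕ) + 1 = (t:ℕ) →
            ((s:ℕ) % 2 = 0 → d s < d t) ∧ ((s:ℕ) % 2 = 1 → d s ≤ d t)),
        (Matrix.of fun r c : Fin m =>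
          if (c:ℕ) % 2 = 0 then B r (d c) else A r (d c)).det) := by
  have h := Byun.final_alg A B
  rw [← Byun.mat_eq] at h
  have hs : ((-1 : R)^(m/2)) * (-1)^(m/2) = 1 := by rw [← mul_pow]; simp
  have h2 : (A * upperTri R n * Bᵀ + B * upperTri R n * Aᵀ + A * Bᵀ).det =
      Byun.Fs 0 A B * Byun.Fs 1 A B := by
    have := congrArg (fun x => (-1 : R)^(m/2) * x) h
    simpa only [← mul_assoc, hs, one_mul] using this
  rw [h2]
  congr 1
  unfold Byun.Fs
  refine Finset.sum_congr ?_ fun d _ => ?_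
  · ext d
    simp only [Finset.mem_filter, Finset.mem_univ, true_and]
    refine forall_congr' fun s => forall_congr' fun t => imp_congr_right fun _ => ?_
    have e1 : ((s:ℕ) + 1) % 2 = 0 ↔ (s:ℕ) % 2 = 1 := by omega
    have e2 : ((s:ℕ) + 1) % 2 = 1 ↔ (s:ℕ) % 2 = 0 := by omega
    rw [e1, e2, and_comm]
  · congr 1
    ext r c
    simp only [Matrix.of_apply]
    by_cases hc : (c:ℕ) % 2 = 0
    · rw [if_pos hc, if_neg (by omega)]
    · rw [if_neg hc, if_pos (by omega)]
end
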